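/- Let f be a multicritical circle map with irrational rotation number and fixed critical point c₀, and set L_n = I_{n+1} and R_n = f^{q_n}(I_n). There exists a constant τ = τ(f) > 0 such that for all n ∈ ℕ and every j ∈ {0, 1, …, q_{n+1}} one has |f^j(L_n)| > τ|f^j(I_n)| and |f^j(R_n)| > τ|f^j(I_n)|. -/

import Mathlib

open Set Filter Topology
open scoped ENNReal

noncomputable section

namespace MCircle

/-- A lift of an orientation-preserving `C³` circle homeomorphism of `S¹ = ℝ/ℤ`:
a `C³`, strictly increasing map commuting with the unit translation. -/
structure IsCircleMapLift (f : ℝ → ℝ) : Prop where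
  smooth : ContDiff ℝ 3 f
  mono : StrictMono f
  periodic : ∀ x : ℝ, f (x + 1) = f x + 1

/-- `c` is a non-flat (power-law) critical point of `f` of criticality `d > 1`:
near `c` we have `f x = f c + φ x * |φ x| ^ (d - 1)` for a `C³` diffeomorphism `φ`
of a neighbourhood `W` of `c` with `φ c = 0`. -/
def IsNonFlatCritPt (f : ℝ → ℝ) (c d : ℝ) : Prop :=
  1 < d ∧ ∃ (W : Set ℝ) (φ : ℝ → ℝ), IsOpen W ∧ c ∈ W ∧
    ContDiffOn ℝ 3 φ W ∧ φ c = 0 ∧ (∀ x ∈ W, deriv φ x ≠ 0) ∧ InjOn φ W ∧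
    ∀ x ∈ W, f x = f c + φ x * |φ x| ^ (d - 1)

/-- `f` is (a lift of) a multicritical circle map: the set of critical points of the
induced circle map, represented in `[0,1)`, is the nonempty finite set `C`, and each
critical point `c ∈ C` is non-flat of criticality `dc c`. -/
def IsMulticriticalLift (f : ℝ → ℝ) (C : Finset ℝ) (dc : ℝ → ℝ) : Prop :=
  IsCircleMapLift f ∧ C.Nonempty ∧ (↑C : Set ℝ) ⊆ Ico (0 : ℝ) 1 ∧
    (∀ x : ℝ, deriv f x = 0 ↔ ∃ c ∈ C, ∃ k : ℤ, x = c + (k : ℝ)) ∧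
    ∀ c ∈ C, IsNonFlatCritPt f c (dc c)

/-- The lift `f` has (translation) rotation number `ρ`. -/
def HasRotNumber (f : ℝ → ℝ) (ρ : ℝ) : Prop :=
  Tendsto (fun n : ℕ => f^[n] 0 / (n : ℝ)) atTop (𝓝 ρ)

/-- `f` is (a lift of) a multicritical circle map with critical set `C` (criticalities
`dc`) and irrational rotation number `ρ`, the lift being normalized so that `ρ ∈ (0,1)`. -/
def GoodMap (f : ℝ → ℝ) (C : Finset ℝ) (dc : ℝ → ℝ) (ρ : ℝ) : Prop :=
  IsMulticriticalLift f C dc ∧ HasRotNumber f ρ ∧ Irrational ρ ∧ ρ ∈ Ioo (0 : ℝ) 1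

/-- The Gauss map. -/
def gaussMap (x : ℝ) : ℝ := Int.fract x⁻¹

/-- The partial quotients `aₙ` of the continued fraction expansion
`ρ = [a₀, a₁, …] = 1/(a₀ + 1/(a₁ + ⋯))`. -/
def cfA (ρ : ℝ) (n : ℕ) : ℕ := ⌊(gaussMap^[n] (Int.fract ρ))⁻¹⌋₊

/-- The denominators `qₙ` of the convergents of `ρ` (the return times):
`q₀ = 1`, `q₁ = a₀`, `q_{n+2} = a_{n+1} q_{n+1} + qₙ`. -/
def qden (ρ : ℝ) : ℕ → ℕ
  | 0 => 1
  | 1 => cfA ρ 0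
  | n + 2 => cfA ρ (n + 1) * qden ρ (n + 1) + qden ρ n

/-- The numerators `pₙ` of the convergents of `ρ`:
`p₀ = 0`, `p₁ = 1`, `p_{n+2} = a_{n+1} p_{n+1} + pₙ`. -/
def pnum (ρ : ℝ) : ℕ → ℕ
  | 0 => 0
  | 1 => 1
  | n + 2 => cfA ρ (n + 1) * pnum ρ (n + 1) + pnum ρ n

/-- The lift representative of the `n`-th closest return `f^{qₙ}(x)`,
normalized (by the integer `pₙ`) to lie at distance less than one from `x`. -/
def retPt (f : ℝ → ℝ) (ρ x : ℝ) (n : ℕ) : ℝ := f^[qden ρ n] x - (pnum ρ n : ℝ)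

/-- The arc `Iₙ(x)`, with endpoints `x` and `f^{qₙ}(x)` and containing `f^{q_{n+2}}(x)`,
realized as an interval in the lift. -/
def arcI (f : ℝ → ℝ) (ρ x : ℝ) (n : ℕ) : Set ℝ := uIcc x (retPt f ρ x n)

/-- The length `|Iₙ(x)|`. -/
def arcLen (f : ℝ → ℝ) (ρ x : ℝ) (n : ℕ) : ℝ := |retPt f ρ x n - x|

/-- The length `|f^j(Iₙ(x))|`. -/
def arcImgLen (f : ℝ → ℝ) (ρ x : ℝ) (n j : ℕ) : ℝ :=
  |f^[j] (retPt f ρ x n) - f^[j] x|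

/-- Indices for the atoms of the `n`-th dynamical partition
`𝒫ₙ(x) = {fⁱ(Iₙ(x)) : 0 ≤ i ≤ q_{n+1}-1} ∪ {f^j(I_{n+1}(x)) : 0 ≤ j ≤ qₙ-1}`. -/
abbrev AtomIdx (ρ : ℝ) (n : ℕ) : Type :=
  {i : ℕ // i < qden ρ (n + 1)} ⊕ {j : ℕ // j < qden ρ n}

/-- Left endpoint (in the lift) of an atom of `𝒫ₙ(x)`. -/
def atomL (f : ℝ → ℝ) (ρ x : ℝ) (n : ℕ) : AtomIdx ρ n → ℝ
  | Sum.inl i => min (f^[i.1] x) (f^[i.1] (retPt f ρ x n))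
  | Sum.inr j => min (f^[j.1] x) (f^[j.1] (retPt f ρ x (n + 1)))

/-- Right endpoint (in the lift) of an atom of `𝒫ₙ(x)`. -/
def atomR (f : ℝ → ℝ) (ρ x : ℝ) (n : ℕ) : AtomIdx ρ n → ℝ
  | Sum.inl i => max (f^[i.1] x) (f^[i.1] (retPt f ρ x n))
  | Sum.inr j => max (f^[j.1] x) (f^[j.1] (retPt f ρ x (n + 1)))

/-- Length of an atom of `𝒫ₙ(x)`. -/
def atomLen (f : ℝ → ℝ) (ρ x : ℝ) (n : ℕ) (A : AtomIdx ρ n) : ℝ :=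
  atomR f ρ x n A - atomL f ρ x n A

/-- Two lift points represent the same point of the circle `ℝ/ℤ`. -/
def SameCirclePt (a b : ℝ) : Prop := ∃ m : ℤ, a = b + (m : ℝ)

/-- Two atoms of `𝒫ₙ(x)` are adjacent: they are distinct and share an endpoint
on the circle. -/
def AdjacentAtoms (f : ℝ → ℝ) (ρ x : ℝ) (n : ℕ) (A B : AtomIdx ρ n) : Prop :=
  A ≠ B ∧ ∃ p ∈ ({atomL f ρ x n A, atomR f ρ x n A} : Set ℝ),
    ∃ q ∈ ({atomL f ρ x n B, atomR f ρ x n B} : Set ℝ), SameCirclePt p q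

/-- `A` is the left neighbour of `Δ` in `𝒫ₙ(x)`. -/
def IsLeftNbr (f : ℝ → ℝ) (ρ x : ℝ) (n : ℕ) (A Δ : AtomIdx ρ n) : Prop :=
  A ≠ Δ ∧ SameCirclePt (atomR f ρ x n A) (atomL f ρ x n Δ)

/-- `B` is the right neighbour of `Δ` in `𝒫ₙ(x)`. -/
def IsRightNbr (f : ℝ → ℝ) (ρ x : ℝ) (n : ℕ) (B Δ : AtomIdx ρ n) : Prop :=
  B ≠ Δ ∧ SameCirclePt (atomL f ρ x n B) (atomR f ρ x n Δ)

/-- The arc `f^j(Δ)` is contained (as a circle arc) in some element of `𝒫ₙ(x)`. -/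
def ImgInAtom (f : ℝ → ℝ) (ρ x : ℝ) (n j : ℕ) (Δ : AtomIdx ρ n) : Prop :=
  ∃ E : AtomIdx ρ n, ∃ m : ℤ,
    atomL f ρ x n E + (m : ℝ) ≤ f^[j] (atomL f ρ x n Δ) ∧
    f^[j] (atomR f ρ x n Δ) ≤ atomR f ρ x n E + (m : ℝ)

/-- An atom of `𝒫ₙ(x)` as a subset of the circle `ℝ/ℤ`. -/
def atomSetC (f : ℝ → ℝ) (ρ x : ℝ) (n : ℕ) (A : AtomIdx ρ n) : Set (AddCircle (1 : ℝ)) :=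
  (fun y : ℝ => (y : AddCircle (1 : ℝ))) '' Icc (atomL f ρ x n A) (atomR f ρ x n A)

/-- The interval `Tₙ = I_{n+1} ∪ Iₙ ∪ f^{qₙ}(Iₙ)`, realized in the lift. -/
def Tset (f : ℝ → ℝ) (ρ x : ℝ) (n : ℕ) : Set ℝ :=
  arcI f ρ x (n + 1) ∪ arcI f ρ x n ∪
    (fun z => f^[qden ρ n] z - (pnum ρ n : ℝ)) '' arcI f ρ x n

/-- `j` is a critical time: `f^j(Tₙ)` contains a critical point of `f` (mod 1). -/
def IsCritTime (f : ℝ → ℝ) (ρ x : ℝ) (C : Finset ℝ) (n j : ℕ) : Prop :=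
  ∃ c ∈ C, ∃ m : ℤ, c + (m : ℝ) ∈ f^[j] '' Tset f ρ x n

/-- The cross-ratio `[M,T] = |L||R|/(|L∪M||M∪R|)` of the configuration
`M = [b,c] ⋐ T = [a,d]` (so `L = [a,b]`, `R = [c,d]`). -/
def crossRatio (a b c d : ℝ) : ℝ := ((b - a) * (d - c)) / ((c - a) * (d - b))

/-- The cross-ratio distortion `CrD(g; M, T)` of `g` on the configuration
`M = [b,c] ⋐ T = [a,d]`. -/
def crD (g : ℝ → ℝ) (a b c d : ℝ) : ℝ :=
  crossRatio (g a) (g b) (g c) (g d) / crossRatio a b c d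

/-- The Schwarzian derivative `Sg = g'''/g' - (3/2)(g''/g')²`. -/
def schwarzian (g : ℝ → ℝ) (x : ℝ) : ℝ :=
  iteratedDeriv 3 g x / deriv g x - (3 / 2) * (iteratedDeriv 2 g x / deriv g x) ^ 2

/-- `g` is a diffeomorphism on `S` with distortion bounded by `K`. -/
def DiffeoWithDistortionLE (g : ℝ → ℝ) (S : Set ℝ) (K : ℝ) : Prop :=
  ContDiffOn ℝ 1 g S ∧ InjOn g S ∧ (∀ x ∈ S, deriv g x ≠ 0) ∧
    ∀ x ∈ S, ∀ y ∈ S, |deriv g x| ≤ K * |deriv g y|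

/-- `g` is a diffeomorphism on `S` with negative Schwarzian derivative. -/
def NegSchwarzDiffeoOn (g : ℝ → ℝ) (S : Set ℝ) : Prop :=
  ContDiffOn ℝ 3 g S ∧ InjOn g S ∧ ∀ x ∈ S, deriv g x ≠ 0 ∧ schwarzian g x < 0

/-- The local quasi-symmetric distortion
`σ_h(x) = lim_{δ→0} limsup_{|t|≤δ} |h(x+t)-h(x)|/|h(x)-h(x-t)|` of a circle
homeomorphism lift `h`, with values in `[0,∞]`. -/
def qsDistortion (h : ℝ → ℝ) (x : ℝ) : ℝ≥0∞ :=
  Filter.limsup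
    (fun t : ℝ => ENNReal.ofReal (|h (x + t) - h x| / |h x - h (x - t)|))
    (𝓝[≠] (0 : ℝ))

end MCircle

open MCircle

namespace MCircle

section CrossRatio

theorem crossRatio_neg (a b c d : ℝ) :
    crossRatio (-d) (-c) (-b) (-a) = crossRatio a b c d := by
  unfold crossRatio
  congr 1 <;> ring

theorem crossRatio_sub_const (a b c d t : ℝ) :
    crossRatio (a - t) (b - t) (c - t) (d - t) = crossRatio a b c d := by
  unfold crossRatio
  congr 1 <;> ring

theorem crossRatio_pos {a b c d : ℝ} (hab : a < b) (hbc : b < c) (hcd : c < d) :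
    0 < crossRatio a b c d := by
  unfold crossRatio
  have h1 := sub_pos.2 hab
  have h2 := sub_pos.2 hcd
  have h3 := sub_pos.2 (hab.trans hbc)
  have h4 := sub_pos.2 (hbc.trans hcd)
  positivity

theorem crossRatio_le_left {a b c d : ℝ} (hab : a < b) (hbc : b < c) (hcd : c < d) :
    crossRatio a b c d ≤ (b - a) / (c - b) := by
  unfold crossRatio
  rw [div_le_div_iff₀ (mul_pos (by linarith) (by linarith)) (by linarith)]
  have h1 : 0 < b - a := by linarith
  have h2 : (d - c) * (c - b) ≤ (c - a) * (d - b) :=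
    calc (d - c) * (c - b) ≤ (d - b) * (c - a) :=
          mul_le_mul (by linarith) (by linarith) (by linarith) (by linarith)
      _ = _ := mul_comm _ _
  nlinarith

theorem crossRatio_le_right {a b c d : ℝ} (hab : a < b) (hbc : b < c) (hcd : c < d) :
    crossRatio a b c d ≤ (d - c) / (c - b) := by
  have h := crossRatio_le_left (neg_lt_neg hcd) (neg_lt_neg hbc) (neg_lt_neg hab)
  rw [crossRatio_neg] at h
  calc _ ≤ _ := h
    _ = _ := by congr 1 <;> ring

/-- The cross-ratio is bounded below when the two gaps are comparable to the middle interval. -/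
theorem le_crossRatio_of_gaps {a b c d s t : ℝ} (hbc : b < c)
    (hs : 0 < s) (ht : 0 < t) (hL : s * (c - b) ≤ b - a) (hR : t * (c - b) ≤ d - c) :
    s / (1 + s) * (t / (1 + t)) ≤ crossRatio a b c d := by
  have hm : 0 < c - b := sub_pos.2 hbc
  have h1 : 0 < b - a := lt_of_lt_of_le (by positivity) hL
  have h2 : 0 < d - c := lt_of_lt_of_le (by positivity) hR
  have e : crossRatio a b c d = (b - a) / (c - a) * ((d - c) / (d - b)) := by
    unfold crossRatio
    rw [div_mul_div_comm]
  rw [e]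
  have k1 : s / (1 + s) ≤ (b - a) / (c - a) := by
    rw [div_le_div_iff₀ (by linarith) (by linarith)]
    nlinarith
  have k2 : t / (1 + t) ≤ (d - c) / (d - b) := by
    rw [div_le_div_iff₀ (by linarith) (by linarith)]
    nlinarith
  exact mul_le_mul k1 k2 (by positivity) (by apply div_nonneg <;> linarith)

/-- Comparison of cross-ratios from comparison of slopes. -/
theorem crossRatio_le_of_slopes {g : ℝ → ℝ} {a b c d K : ℝ} (hab : a < b) (hbc : b < c)
    (hcd : c < d) (hg : StrictMonoOn g (Icc a d))
    (hL : (g b - g a) * (c - a) ≤ K * ((g c - g a) * (b - a)))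
    (hR : (g d - g c) * (d - b) ≤ K * ((g d - g b) * (d - c))) :
    crossRatio (g a) (g b) (g c) (g d) ≤ K * K * crossRatio a b c d := by
  have m1 : g a < g b := hg ⟨le_rfl, by linarith⟩ ⟨by linarith, by linarith⟩ hab
  have m2 : g b < g c := hg ⟨by linarith, by linarith⟩ ⟨by linarith, by linarith⟩ hbc
  have m3 : g c < g d := hg ⟨by linarith, by linarith⟩ ⟨by linarith, le_rfl⟩ hcd
  unfold crossRatio
  rw [← mul_div_assoc, div_le_div_iff₀ (mul_pos (by linarith) (by linarith))
    (mul_pos (by linarith) (by linarith))]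
  have h := mul_le_mul hL hR (mul_nonneg (by linarith) (by linarith))
    (le_trans (mul_nonneg (by linarith) (by linarith)) hL)
  calc _ = (g b - g a) * (c - a) * ((g d - g c) * (d - b)) := by ring
    _ ≤ _ := h
    _ = _ := by ring

end CrossRatio

section PowerMap

theorem sinh_mul_le_mul_sinh {s t u : ℝ} (hs : 1 ≤ s) (ht : 0 < t) (htu : t ≤ u) :
    Real.sinh (s * t) * Real.sinh u ≤ Real.sinh (s * u) * Real.sinh t := by
  have key : ∀ x : ℝ, 0 ≤ x →
      Real.sinh (s * x) * Real.cosh x ≤ s * Real.cosh (s * x) * Real.sinh x := by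
    intro x hx
    let F : ℝ → ℝ := fun x => s * Real.cosh (s * x) * Real.sinh x - Real.sinh (s * x) * Real.cosh x
    have hF : ∀ x, HasDerivAt F ((s ^ 2 - 1) * (Real.sinh (s * x) * Real.sinh x)) x := by
      intro x
      have hm : HasDerivAt (fun x : ℝ => s * x) s x := by
        simpa using (hasDerivAt_id x).const_mul s
      have h1 := ((hm.cosh.const_mul s).mul (Real.hasDerivAt_sinh x)).sub
        (hm.sinh.mul (Real.hasDerivAt_cosh x))
      exact h1.congr_deriv (by ring)
    have hmono : MonotoneOn F (Ici 0) := by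
      apply monotoneOn_of_deriv_nonneg (convex_Ici 0)
      · exact fun x _ => (hF x).continuousAt.continuousWithinAt
      · exact fun x _ => (hF x).differentiableAt.differentiableWithinAt
      · intro x hx
        rw [interior_Ici] at hx
        rw [(hF x).deriv]
        have h1 : 0 ≤ Real.sinh x := Real.sinh_nonneg_iff.2 (le_of_lt hx)
        have h2 : 0 ≤ Real.sinh (s * x) :=
          Real.sinh_nonneg_iff.2 (mul_nonneg (by linarith) (le_of_lt hx))
        have h3 : 0 ≤ s ^ 2 - 1 := by nlinarith
        positivity
    have := hmono (mem_Ici.2 le_rfl) (mem_Ici.2 hx) hx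
    simp only [F, mul_zero, Real.sinh_zero, zero_mul, sub_zero] at this
    linarith
  let G : ℝ → ℝ := fun x => Real.sinh (s * x) / Real.sinh x
  have hG : ∀ x, 0 < x → HasDerivAt G
      ((s * Real.cosh (s * x) * Real.sinh x - Real.sinh (s * x) * Real.cosh x) /
        Real.sinh x ^ 2) x := by
    intro x hx
    have hm : HasDerivAt (fun x : ℝ => s * x) s x := by
      simpa using (hasDerivAt_id x).const_mul s
    have h1 := hm.sinh.div (Real.hasDerivAt_sinh x) (Real.sinh_pos_iff.2 hx).ne'
    exact h1.congr_deriv (by ring)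
  have hmono : MonotoneOn G (Ioi 0) := by
    apply monotoneOn_of_deriv_nonneg (convex_Ioi 0)
    · exact fun x hx => (hG x hx).continuousAt.continuousWithinAt
    · rw [interior_Ioi]
      exact fun x hx => (hG x hx).differentiableAt.differentiableWithinAt
    · intro x hx
      rw [interior_Ioi] at hx
      rw [(hG x hx).deriv]
      have := key x (le_of_lt hx)
      apply div_nonneg (by linarith) (sq_nonneg _)
  have h := hmono (mem_Ioi.2 ht) (mem_Ioi.2 (ht.trans_le htu)) htu
  simp only [G] at h
  rwa [div_le_div_iff₀ (Real.sinh_pos_iff.2 ht) (Real.sinh_pos_iff.2 (ht.trans_le htu))] at h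

theorem exp_sub_exp_eq (x y : ℝ) :
    Real.exp (2 * y) - Real.exp (2 * x) = 2 * Real.exp (x + y) * Real.sinh (y - x) := by
  rw [Real.sinh_eq]
  have h1 : Real.exp (x + y) * Real.exp (y - x) = Real.exp (2 * y) := by
    rw [← Real.exp_add]; ring_nf
  have h2 : Real.exp (x + y) * Real.exp (-(y - x)) = Real.exp (2 * x) := by
    rw [← Real.exp_add]; ring_nf
  linear_combination -h1 + h2

theorem crossRatio_exp (A B C D : ℝ) :
    crossRatio (Real.exp (2 * A)) (Real.exp (2 * B)) (Real.exp (2 * C)) (Real.exp (2 * D)) =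
      (Real.sinh (B - A) * Real.sinh (D - C)) / (Real.sinh (C - A) * Real.sinh (D - B)) := by
  unfold crossRatio
  simp only [exp_sub_exp_eq]
  have h : Real.exp (A + B) * Real.exp (C + D) = Real.exp (A + C) * Real.exp (B + D) := by
    rw [← Real.exp_add, ← Real.exp_add]; ring_nf
  have hne : 4 * (Real.exp (A + C) * Real.exp (B + D)) ≠ 0 := by positivity
  conv_rhs => rw [← mul_div_mul_left _ _ hne]
  congr 1
  · linear_combination 4 * Real.sinh (B - A) * Real.sinh (D - C) * h
  · ring

/-- Power maps contract cross-ratios on the positive half-line. -/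
theorem crossRatio_rpow_le {a b c d s : ℝ} (hs : 1 ≤ s) (ha : 0 < a) (hab : a < b)
    (hbc : b < c) (hcd : c < d) :
    crossRatio (a ^ s) (b ^ s) (c ^ s) (d ^ s) ≤ crossRatio a b c d := by
  have rep : ∀ x : ℝ, 0 < x → x = Real.exp (2 * (Real.log x / 2)) := fun x hx => by
    rw [mul_div_cancel₀ _ two_ne_zero, Real.exp_log hx]
  have reps : ∀ x : ℝ, 0 < x → x ^ s = Real.exp (2 * (s * (Real.log x / 2))) := fun x hx => by
    rw [Real.rpow_def_of_pos hx]; ring_nf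
  have hb := ha.trans hab
  have hc := hb.trans hbc
  have hd := hc.trans hcd
  have lab := Real.log_lt_log ha hab
  have lbc := Real.log_lt_log hb hbc
  have lcd := Real.log_lt_log hc hcd
  rw [reps a ha, reps b hb, reps c hc, reps d hd, crossRatio_exp]
  conv_rhs => rw [rep a ha, rep b hb, rep c hc, rep d hd, crossRatio_exp]
  simp only [← mul_sub]
  set A := Real.log a / 2
  set B := Real.log b / 2
  set C := Real.log c / 2
  set D := Real.log d / 2
  have hAB : 0 < B - A := by simp only [A, B]; linarith
  have hBC : 0 < C - B := by simp only [C, B]; linarith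
  have hCD : 0 < D - C := by simp only [C, D]; linarith
  have pos : ∀ x : ℝ, 0 < x → 0 < Real.sinh x := fun x hx => Real.sinh_pos_iff.2 hx
  have poss : ∀ x : ℝ, 0 < x → 0 < Real.sinh (s * x) := fun x hx =>
    Real.sinh_pos_iff.2 (mul_pos (by linarith) hx)
  have hCA : 0 < C - A := by linarith
  have hDB : 0 < D - B := by linarith
  rw [div_le_div_iff₀ (mul_pos (poss _ hCA) (poss _ hDB)) (mul_pos (pos _ hCA) (pos _ hDB))]
  have h1 := sinh_mul_le_mul_sinh hs hAB (show B - A ≤ C - A by linarith)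
  have h2 := sinh_mul_le_mul_sinh hs hCD (show D - C ≤ D - B by linarith)
  have h := mul_le_mul h1 h2 (mul_pos (poss _ hCD) (pos _ hDB)).le
    (mul_pos (poss _ hCA) (pos _ hAB)).le
  calc _ = Real.sinh (s * (B - A)) * Real.sinh (C - A) *
        (Real.sinh (s * (D - C)) * Real.sinh (D - B)) := by ring
    _ ≤ _ := h
    _ = _ := by ring

/-- The odd extension `x ↦ x |x| ^ (s - 1)` of the power map. -/
def oddPow (s x : ℝ) : ℝ := x * |x| ^ (s - 1)

theorem oddPow_neg (s x : ℝ) : oddPow s (-x) = -oddPow s x := by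
  simp [oddPow]

theorem oddPow_of_pos {s x : ℝ} (hx : 0 < x) : oddPow s x = x ^ s := by
  rw [oddPow, abs_of_pos hx, Real.rpow_sub_one hx.ne']
  field_simp

theorem oddPow_zero (s : ℝ) : oddPow s 0 = 0 := by simp [oddPow]

theorem oddPow_of_nonneg {s x : ℝ} (hs : 1 < s) (hx : 0 ≤ x) : oddPow s x = x ^ s := by
  rcases hx.eq_or_lt with rfl | hx
  · rw [oddPow_zero, Real.zero_rpow (by linarith)]
  · exact oddPow_of_pos hx

theorem crossRatio_oddPow_le_of_pos {a b c d s : ℝ} (hs : 1 ≤ s) (ha : 0 < a) (hab : a < b)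
    (hbc : b < c) (hcd : c < d) :
    crossRatio (oddPow s a) (oddPow s b) (oddPow s c) (oddPow s d) ≤ crossRatio a b c d := by
  rw [oddPow_of_pos ha, oddPow_of_pos (ha.trans hab), oddPow_of_pos (by linarith),
    oddPow_of_pos (by linarith)]
  exact crossRatio_rpow_le hs ha hab hbc hcd

theorem crossRatio_oddPow_le_of_neg {a b c d s : ℝ} (hs : 1 ≤ s) (hd : d < 0) (hab : a < b)
    (hbc : b < c) (hcd : c < d) :
    crossRatio (oddPow s a) (oddPow s b) (oddPow s c) (oddPow s d) ≤ crossRatio a b c d := by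
  have h := crossRatio_oddPow_le_of_pos hs (neg_pos.2 hd) (neg_lt_neg hcd) (neg_lt_neg hbc)
    (neg_lt_neg hab)
  simpa only [oddPow_neg, crossRatio_neg] using h

/-- Lower bound for the increment of the odd power map. -/
theorem oddPow_sub_ge {s u v m : ℝ} (hs : 1 < s) (huv : u ≤ v) (hm : m = max |u| |v|) :
    m ^ (s - 1) * (v - u) ≤ 2 * (oddPow s v - oddPow s u) := by
  have hs0 : 0 ≤ s - 1 := by linarith
  have pos_case : ∀ x y : ℝ, 0 ≤ x → x ≤ y →
      y ^ (s - 1) * (y - x) ≤ 2 * (oddPow s y - oddPow s x) := by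
    intro x y hx hxy
    simp only [oddPow, abs_of_nonneg hx, abs_of_nonneg (hx.trans hxy)]
    have h := Real.rpow_le_rpow hx hxy hs0
    have h0 := Real.rpow_nonneg hx (s - 1)
    nlinarith [mul_le_mul_of_nonneg_left h hx]
  rcases le_total 0 u with hu | hu
  · rw [hm, abs_of_nonneg hu, abs_of_nonneg (hu.trans huv), max_eq_right huv]
    exact pos_case u v hu huv
  rcases le_total v 0 with hv | hv
  · have h := pos_case (-v) (-u) (by linarith) (by linarith)
    rw [oddPow_neg, oddPow_neg] at h
    rw [hm, abs_of_nonpos hu, abs_of_nonpos hv, max_eq_left (by linarith)]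
    linarith
  · rw [hm, abs_of_nonpos hu, abs_of_nonneg hv]
    simp only [oddPow, abs_of_nonpos hu, abs_of_nonneg hv]
    have h1 := Real.rpow_nonneg hv (s - 1)
    have h2 := Real.rpow_nonneg (neg_nonneg.2 hu) (s - 1)
    rcases le_total (-u) v with h | h
    · rw [max_eq_right h]; nlinarith
    · rw [max_eq_left h]; nlinarith

/-- Upper bound for the increment of the odd power map. -/
theorem oddPow_sub_le {s u v m : ℝ} (hs : 1 < s) (huv : u ≤ v) (hu : |u| ≤ m) (hv : |v| ≤ m) :
    oddPow s v - oddPow s u ≤ 2 * s * m ^ (s - 1) * (v - u) := by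
  have hs0 : 0 ≤ s - 1 := by linarith
  have pos_case : ∀ x y : ℝ, 0 ≤ x → x ≤ y → y ≤ m →
      oddPow s y - oddPow s x ≤ s * m ^ (s - 1) * (y - x) := by
    intro x y hx hxy hy
    rcases hxy.eq_or_lt with rfl | hxy
    · simp
    rw [oddPow_of_nonneg hs hx, oddPow_of_nonneg hs (hx.trans hxy.le)]
    obtain ⟨ξ, hξ, e⟩ := exists_deriv_eq_slope (fun x : ℝ => x ^ s) hxy
      (Real.continuous_rpow_const (by linarith)).continuousOn
      (fun z hz => (Real.differentiableAt_rpow_const_of_ne s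
        (by linarith [hz.1])).differentiableWithinAt)
    rw [Real.deriv_rpow_const, eq_div_iff (by linarith)] at e
    rw [← e]
    have : ξ ^ (s - 1) ≤ m ^ (s - 1) :=
      Real.rpow_le_rpow (by linarith [hξ.1]) (by linarith [hξ.2]) hs0
    have h1 : 0 ≤ y - x := by linarith
    gcongr
  have hm0 : 0 ≤ m := (abs_nonneg u).trans hu
  have hmp := Real.rpow_nonneg hm0 (s - 1)
  have hK : 0 ≤ s * m ^ (s - 1) := by positivity
  have hu' := abs_le.1 hu
  have hv' := abs_le.1 hv
  rcases le_total 0 u with h0 | h0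
  · nlinarith [pos_case u v h0 huv hv'.2]
  rcases le_total v 0 with h1 | h1
  · have h := pos_case (-v) (-u) (by linarith) (by linarith) (by linarith)
    rw [oddPow_neg, oddPow_neg] at h
    nlinarith
  · have h := pos_case 0 v le_rfl h1 hv'.2
    have h' := pos_case 0 (-u) le_rfl (by linarith) (by linarith)
    rw [oddPow_neg] at h'
    rw [oddPow_zero] at h h'
    nlinarith

end PowerMap

section LocalDistortion

/-- A `C²` map with positive derivative has distortion controlled by the length of the interval. -/
theorem exists_local_distortion {ψ : ℝ → ℝ} {p : ℝ} (hψ : ContDiffAt ℝ 2 ψ p)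
    (hp : 0 < deriv ψ p) :
    ∃ δ > 0, ∃ κ ≥ 0, StrictMonoOn ψ (Ioo (p - δ) (p + δ)) ∧
      ∀ s a b t, p - δ < s → s ≤ a → a < b → b ≤ t → t < p + δ →
        (ψ b - ψ a) * (t - s) ≤ Real.exp (κ * (t - s)) * ((ψ t - ψ s) * (b - a)) := by
  have hd : ∀ᶠ x in 𝓝 p, DifferentiableAt ℝ ψ x := by
    filter_upwards [hψ.eventually (by simp)] with x hx
    exact hx.differentiableAt (by norm_num)
  have hC1 : ContDiffAt ℝ 1 (deriv ψ) p := by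
    exact (hψ.fderiv_right (m := 1) (by norm_num)).clm_apply contDiffAt_const
  obtain ⟨K, U, hU, hLip⟩ := hC1.exists_lipschitzOnWith
  have hpos : ∀ᶠ x in 𝓝 p, deriv ψ p / 2 < deriv ψ x :=
    hC1.continuousAt.eventually (lt_mem_nhds (by linarith))
  obtain ⟨δ, hδ, hball⟩ := Metric.eventually_nhds_iff_ball.1 (hd.and (hpos.and hU))
  have hmem : ∀ x ∈ Ioo (p - δ) (p + δ), x ∈ Metric.ball p δ := by
    intro x hx
    rwa [Real.ball_eq_Ioo]
  set m := deriv ψ p / 2 with hm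
  have hm0 : 0 < m := by positivity
  have slope : ∀ a b, p - δ < a → a < b → b < p + δ →
      ∃ ξ ∈ Ioo a b, ψ b - ψ a = deriv ψ ξ * (b - a) := by
    intro a b ha hab hb
    obtain ⟨ξ, hξ, e⟩ := exists_deriv_eq_slope ψ hab
      (fun x hx => (hball x (hmem x ⟨by linarith [hx.1], by linarith [hx.2]⟩)).1.continuousAt.continuousWithinAt)
      (fun x hx => (hball x (hmem x ⟨by linarith [hx.1], by linarith [hx.2]⟩)).1.differentiableWithinAt)
    exact ⟨ξ, hξ, by rw [e, div_mul_cancel₀ _ (by linarith)]⟩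
  refine ⟨δ, hδ, K / m, by positivity, ?_, ?_⟩
  · intro a ha b hb hab
    obtain ⟨ξ, hξ, e⟩ := slope a b ha.1 hab hb.2
    have := (hball ξ (hmem ξ ⟨by linarith [hξ.1, ha.1], by linarith [hξ.2, hb.2]⟩)).2.1
    nlinarith [mul_pos (hm0.trans this) (sub_pos.2 hab)]
  · intro s a b t hs hsa hab hbt ht
    obtain ⟨ξ, hξ, e⟩ := slope a b (by linarith) hab (by linarith)
    obtain ⟨η, hη, e'⟩ := slope s t hs (by linarith) ht
    rw [e, e']
    have hξb := (hball ξ (hmem ξ ⟨by linarith [hξ.1], by linarith [hξ.2]⟩)).2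
    have hηb := (hball η (hmem η ⟨by linarith [hη.1], by linarith [hη.2]⟩)).2
    have hdist := hLip.dist_le_mul ξ hξb.2 η hηb.2
    rw [Real.dist_eq, Real.dist_eq] at hdist
    have h1 : |ξ - η| ≤ t - s :=
      abs_le.2 ⟨by linarith [hξ.1, hη.2], by linarith [hξ.2, hη.1]⟩
    have hK : (0 : ℝ) ≤ K := K.2
    have h2 : deriv ψ ξ ≤ deriv ψ η + K * (t - s) := by
      have := (abs_le.1 (hdist.trans (mul_le_mul_of_nonneg_left h1 hK))).2
      linarith
    have h3 : deriv ψ η + K * (t - s) ≤ deriv ψ η * (1 + K / m * (t - s)) := by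
      have : (K : ℝ) * (t - s) ≤ deriv ψ η * (K / m * (t - s)) := by
        have h5 : (K : ℝ) * (t - s) = m * (K / m * (t - s)) := by field_simp
        rw [h5]
        apply mul_le_mul_of_nonneg_right hηb.1.le
        have : 0 ≤ t - s := by linarith
        positivity
      linarith
    have h4 : 1 + K / m * (t - s) ≤ Real.exp (K / m * (t - s)) := by
      linarith [Real.add_one_le_exp (K / m * (t - s))]
    have h6 : deriv ψ ξ ≤ Real.exp (K / m * (t - s)) * deriv ψ η := by
      nlinarith [hηb.1]
    have h7 : 0 ≤ (b - a) * (t - s) := mul_nonneg (by linarith) (by linarith)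
    calc _ = deriv ψ ξ * ((b - a) * (t - s)) := by ring
      _ ≤ Real.exp (K / m * (t - s)) * deriv ψ η * ((b - a) * (t - s)) :=
        mul_le_mul_of_nonneg_right h6 h7
      _ = _ := by ring

/-- Passing from local to uniform statements about short intervals, for a periodic property. -/
theorem exists_uniform_of_local {R : ℝ → ℝ → ℝ → Prop}
    (mono : ∀ κ κ' s t, κ ≤ κ' → R κ s t → R κ' s t)
    (per : ∀ κ s t, ∀ k : ℤ, R κ s t → R κ (s + k) (t + k))
    (loc : ∀ p, ∃ δ > 0, ∃ κ, ∀ s t, p - δ < s → s < t → t < p + δ → R κ s t) :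
    ∃ δ > 0, ∃ κ, ∀ s t, s < t → t < s + δ → R κ s t := by
  have key : ∃ δ > 0, ∃ κ, ∀ s ∈ Icc (0 : ℝ) 1, ∀ t, s < t → t < s + δ → R κ s t := by
    refine isCompact_Icc.induction_on
      (p := fun S : Set ℝ => ∃ δ > 0, ∃ κ, ∀ s ∈ S, ∀ t, s < t → t < s + δ → R κ s t)
      ⟨1, one_pos, 0, by simp⟩ ?_ ?_ ?_
    · rintro S T hST ⟨δ, hδ, κ, h⟩
      exact ⟨δ, hδ, κ, fun s hs => h s (hST hs)⟩
    · rintro S T ⟨δ, hδ, κ, h⟩ ⟨δ', hδ', κ', h'⟩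
      refine ⟨min δ δ', lt_min hδ hδ', max κ κ', ?_⟩
      rintro s (hs | hs) t hst ht
      · exact mono _ _ _ _ (le_max_left _ _) (h s hs t hst (by linarith [min_le_left δ δ']))
      · exact mono _ _ _ _ (le_max_right _ _) (h' s hs t hst (by linarith [min_le_right δ δ']))
    · intro p _
      obtain ⟨δ, hδ, κ, h⟩ := loc p
      refine ⟨Ioo (p - δ / 2) (p + δ / 2),
        mem_nhdsWithin_of_mem_nhds (Ioo_mem_nhds (by linarith) (by linarith)),
        δ / 2, by positivity, κ, ?_⟩
      intro s hs t hst ht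
      exact h s t (by linarith [hs.1]) hst (by linarith [hs.2])
  obtain ⟨δ, hδ, κ, h⟩ := key
  refine ⟨δ, hδ, κ, fun s t hst ht => ?_⟩
  have h1 := h (s - ⌊s⌋) ⟨by linarith [Int.floor_le s], by linarith [Int.lt_floor_add_one s]⟩
    (t - ⌊s⌋) (by linarith) (by linarith)
  simpa using per _ _ _ ⌊s⌋ h1

/-- A continuous periodic function attains its minimum. -/
theorem exists_min_of_periodic {u : ℝ → ℝ} (hc : Continuous u) (hper : ∀ x, u (x + 1) = u x) :
    ∃ z, ∀ y, u z ≤ u y := by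
  have hp : Function.Periodic u 1 := hper
  have hcomp := hp.compact_of_continuous one_ne_zero hc
  obtain ⟨_, ⟨z, rfl⟩, hz⟩ := hcomp.exists_isLeast (range_nonempty u)
  exact ⟨z, fun y => hz ⟨y, rfl⟩⟩

end LocalDistortion

section CriticalPoints

theorem add_int_of_add_one {u : ℝ → ℝ} {Λ : ℝ} (h : ∀ x, u (x + 1) = u x + Λ) (x : ℝ) (k : ℤ) :
    u (x + k) = u x + k * Λ := by
  induction k using Int.induction_on with
  | zero => simp
  | succ n ih =>
    push_cast at ih ⊢
    rw [← add_assoc, h, ih]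
    ring
  | pred n ih =>
    push_cast at ih ⊢
    have := h (x + (-n - 1))
    rw [add_assoc, sub_add_cancel, ih] at this
    linarith

theorem IsCircleMapLift.add_int {f : ℝ → ℝ} (hf : IsCircleMapLift f) (x : ℝ) (k : ℤ) :
    f (x + k) = f x + k := by
  rw [add_int_of_add_one hf.periodic, mul_one]

/-- Near a non-flat critical point, `f` is an odd power composed with an increasing map of
controlled distortion. -/
theorem IsNonFlatCritPt.exists_local_form {f : ℝ → ℝ} {c d : ℝ} (hmono : StrictMono f)
    (h : IsNonFlatCritPt f c d) :
    ∃ φ : ℝ → ℝ, ∃ δ > 0, ContDiffAt ℝ 2 φ c ∧ 0 < deriv φ c ∧ φ c = 0 ∧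
      ∀ x ∈ Ioo (c - δ) (c + δ), f x = f c + oddPow d (φ x) := by
  obtain ⟨hd, W, φ, hW, hcW, hφ, h0, hφ', -, hrep⟩ := h
  have hcd : ContDiffAt ℝ 2 φ c := (hφ.contDiffAt (hW.mem_nhds hcW)).of_le (by norm_num)
  obtain ⟨δ, hδ, hball⟩ := Metric.isOpen_iff.1 hW c hcW
  rw [Real.ball_eq_Ioo] at hball
  refine ⟨φ, δ, hδ, hcd, ?_, h0, fun x hx => hrep x (hball hx)⟩
  refine lt_of_le_of_ne ?_ (hφ' c hcW).symm
  by_contra! hneg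
  obtain ⟨δ', hδ', κ, -, hanti, -⟩ := exists_local_distortion (ψ := fun x => -φ x) hcd.neg
    (by simpa [deriv.fun_neg] using hneg)
  set x := c + min δ δ' / 2 with hx
  have hpos : 0 < min δ δ' := lt_min hδ hδ'
  have hm1 := min_le_left δ δ'
  have hm2 := min_le_right δ δ'
  have hlt := hanti (show c ∈ Ioo (c - δ') (c + δ') from ⟨by linarith, by linarith⟩)
    (show x ∈ Ioo (c - δ') (c + δ') from ⟨by linarith, by linarith⟩) (by linarith)
  simp only [h0, neg_zero] at hlt
  have hφx : φ x < 0 := by linarith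
  have h1 := hrep x (hball ⟨by linarith, by linarith⟩)
  have h2 : f c < f x := hmono (by linarith)
  have h3 : 0 < |φ x| ^ (d - 1) := Real.rpow_pos_of_pos (abs_pos.2 hφx.ne) _
  nlinarith

/-- Every critical point of the lift has the local power-law form. -/
theorem IsMulticriticalLift.exists_local_form {f : ℝ → ℝ} {C : Finset ℝ} {dc : ℝ → ℝ}
    (hf : IsMulticriticalLift f C dc) {p : ℝ} (hp : deriv f p = 0) :
    ∃ d > 1, ∃ φ : ℝ → ℝ, ∃ δ > 0, ContDiffAt ℝ 2 φ p ∧ 0 < deriv φ p ∧ φ p = 0 ∧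
      ∀ x ∈ Ioo (p - δ) (p + δ), f x = f p + oddPow d (φ x) := by
  obtain ⟨hlift, -, -, hcrit, hflat⟩ := hf
  obtain ⟨c, hc, k, rfl⟩ := (hcrit p).1 hp
  obtain ⟨φ, δ, hδ, h1, h2, h3, h4⟩ := (hflat c hc).exists_local_form hlift.mono
  refine ⟨dc c, (hflat c hc).1, fun x => φ (x - k), δ, hδ, ?_, ?_, ?_, ?_⟩
  · apply ContDiffAt.comp (c + (k : ℝ))
    · simpa using h1
    · exact contDiffAt_id.sub contDiffAt_const
  · rw [deriv_comp_sub_const]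
    simpa using h2
  · simpa using h3
  · intro x hx
    have h5 := h4 (x - k) ⟨by linarith [hx.1], by linarith [hx.2]⟩
    have h6 := hlift.add_int (x - k) k
    rw [sub_add_cancel] at h6
    rw [h6, hlift.add_int, h5]
    ring

/-- A composition of a map with an odd power map satisfies a slope bound. -/
theorem oddPow_comp_slope_bound {φ : ℝ → ℝ} {S : Set ℝ} {d D s a b t : ℝ} (hd : 1 < d)
    (hφ : StrictMonoOn φ S) (hs : s ∈ S) (ha : a ∈ S) (hb : b ∈ S) (ht : t ∈ S)
    (hsa : s ≤ a) (hab : a < b) (hbt : b ≤ t)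
    (hD : (φ b - φ a) * (t - s) ≤ D * ((φ t - φ s) * (b - a))) :
    (oddPow d (φ b) - oddPow d (φ a)) * (t - s) ≤
      4 * d * D * ((oddPow d (φ t) - oddPow d (φ s)) * (b - a)) := by
  have m1 : φ s ≤ φ a := hφ.monotoneOn hs ha hsa
  have m2 : φ a < φ b := hφ ha hb hab
  have m3 : φ b ≤ φ t := hφ.monotoneOn hb ht hbt
  set m := max |φ s| |φ t| with hm
  have e1 : |φ a| ≤ m := abs_le_max_abs_abs m1 (m2.le.trans m3)
  have e2 : |φ b| ≤ m := abs_le_max_abs_abs (m1.trans m2.le) m3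
  have h1 := oddPow_sub_le hd m2.le e1 e2
  have h2 := oddPow_sub_ge hd (show φ s ≤ φ t by linarith) hm
  have hm0 : 0 ≤ m ^ (d - 1) := Real.rpow_nonneg ((abs_nonneg _).trans e1) _
  have hst : 0 ≤ t - s := by linarith
  have hba : 0 < b - a := by linarith
  have hD0 : 0 ≤ D := by
    by_contra! hneg
    have : 0 ≤ (φ b - φ a) * (t - s) := mul_nonneg (by linarith) hst
    have h3 : 0 < (φ t - φ s) * (b - a) := mul_pos (by linarith) hba
    nlinarith
  calc _ ≤ 2 * d * m ^ (d - 1) * (φ b - φ a) * (t - s) := mul_le_mul_of_nonneg_right h1 hst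
    _ = 2 * d * m ^ (d - 1) * ((φ b - φ a) * (t - s)) := by ring
    _ ≤ 2 * d * m ^ (d - 1) * (D * ((φ t - φ s) * (b - a))) := by gcongr
    _ = 2 * d * D * (b - a) * (m ^ (d - 1) * (φ t - φ s)) := by ring
    _ ≤ 2 * d * D * (b - a) * (2 * (oddPow d (φ t) - oddPow d (φ s))) := by gcongr
    _ = _ := by ring

theorem IsMulticriticalLift.deriv_nonneg {f : ℝ → ℝ} {C : Finset ℝ} {dc : ℝ → ℝ}
    (hf : IsMulticriticalLift f C dc) (p : ℝ) : 0 ≤ deriv f p :=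
  hf.1.mono.monotone.deriv_nonneg

/-- Slopes of `f` on subintervals are bounded by a multiple of the slope on the interval,
locally around any point. -/
theorem IsMulticriticalLift.exists_local_slope_bound {f : ℝ → ℝ} {C : Finset ℝ} {dc : ℝ → ℝ}
    (hf : IsMulticriticalLift f C dc) (p : ℝ) :
    ∃ δ > 0, ∃ K : ℝ, ∀ s t, p - δ < s → s < t → t < p + δ →
      ∀ a b, s ≤ a → a < b → b ≤ t → (f b - f a) * (t - s) ≤ K * ((f t - f s) * (b - a)) := by
  rcases (hf.deriv_nonneg p).eq_or_lt with hp | hp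
  · obtain ⟨d, hd, φ, δ₁, hδ₁, h1, h2, -, hrep⟩ := hf.exists_local_form hp.symm
    obtain ⟨δ₂, hδ₂, κ, hκ, hmono, hdist⟩ := exists_local_distortion h1 h2
    have hδ : 0 < min δ₁ δ₂ := lt_min hδ₁ hδ₂
    have l1 := min_le_left δ₁ δ₂
    have l2 := min_le_right δ₁ δ₂
    refine ⟨min δ₁ δ₂, hδ, 4 * d * Real.exp (κ * (2 * δ₂)), ?_⟩
    intro s t hs hst ht a b hsa hab hbt
    rw [hrep s ⟨by linarith, by linarith⟩, hrep t ⟨by linarith, by linarith⟩,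
      hrep a ⟨by linarith, by linarith⟩, hrep b ⟨by linarith, by linarith⟩]
    simp only [add_sub_add_left_eq_sub]
    refine oddPow_comp_slope_bound hd hmono ⟨by linarith, by linarith⟩
      ⟨by linarith, by linarith⟩ ⟨by linarith, by linarith⟩ ⟨by linarith, by linarith⟩
      hsa hab hbt ?_
    refine (hdist s a b t (by linarith) hsa hab hbt (by linarith)).trans ?_
    have : 0 ≤ (φ t - φ s) * (b - a) := mul_nonneg (sub_nonneg.2
      (hmono.monotoneOn ⟨by linarith, by linarith⟩ ⟨by linarith, by linarith⟩ hst.le))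
      (by linarith)
    gcongr
    linarith
  · obtain ⟨δ, hδ, κ, hκ, -, hdist⟩ :=
      exists_local_distortion (hf.1.smooth.contDiffAt.of_le (by norm_num)) hp
    refine ⟨δ, hδ, Real.exp (κ * (2 * δ)), ?_⟩
    intro s t hs hst ht a b hsa hab hbt
    refine (hdist s a b t hs hsa hab hbt ht).trans ?_
    have : 0 ≤ (f t - f s) * (b - a) :=
      mul_nonneg (sub_nonneg.2 (hf.1.mono.monotone hst.le)) (by linarith)
    gcongr
    linarith

theorem IsCircleMapLift.exists_slope_upper_bound {f : ℝ → ℝ} (hf : IsCircleMapLift f) :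
    ∃ S > 0, ∀ a b, a ≤ b → f b - f a ≤ S * (b - a) := by
  have hc : Continuous (deriv f) := hf.smooth.continuous_deriv (by norm_num)
  have hper : ∀ x, -deriv f (x + 1) = -deriv f x := by
    intro x
    rw [← deriv_comp_add_const, funext hf.periodic, deriv_add_const]
  obtain ⟨z, hz⟩ := exists_min_of_periodic hc.neg hper
  refine ⟨|deriv f z| + 1, by positivity, fun a b hab => ?_⟩
  refine Convex.image_sub_le_mul_sub_of_deriv_le convex_univ hf.smooth.continuous.continuousOn
    (hf.smooth.differentiable (by norm_num)).differentiableOn (fun x _ => ?_) a trivial b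
    trivial hab
  have := hz x
  simp only [Pi.neg_apply] at this
  linarith [le_abs_self (deriv f z)]

theorem IsCircleMapLift.exists_slope_lower_bound {f : ℝ → ℝ} (hf : IsCircleMapLift f) {δ : ℝ}
    (hδ : 0 < δ) : ∃ σ > 0, ∀ s t, s + δ ≤ t → σ * (t - s) ≤ f t - f s := by
  have hc : Continuous fun x => f (x + δ) - f x := by
    have := hf.smooth.continuous
    fun_prop
  obtain ⟨z, hz⟩ := exists_min_of_periodic hc fun x => by
    rw [add_right_comm, hf.periodic, hf.periodic]; ring
  set μ := f (z + δ) - f z with hμ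
  have hμ0 : 0 < μ := sub_pos.2 (hf.mono (by linarith))
  have step : ∀ n : ℕ, ∀ s, n * μ ≤ f (s + n * δ) - f s := by
    intro n s
    induction n with
    | zero => simp
    | succ n ih =>
      have := hz (s + n * δ)
      push_cast
      rw [show s + (n + 1) * δ = s + n * δ + δ by ring]
      linarith
  refine ⟨μ / (2 * δ), by positivity, fun s t hst => ?_⟩
  have h1 : 1 ≤ (t - s) / δ := by rw [le_div_iff₀ hδ]; linarith
  set n := ⌊(t - s) / δ⌋₊ with hn
  have hn1 : (n : ℝ) ≤ (t - s) / δ := Nat.floor_le (by linarith)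
  have hn2 : (t - s) / δ < n + 1 := Nat.lt_floor_add_one _
  have hn3 : (1 : ℝ) ≤ n := by
    exact_mod_cast (Nat.le_floor (by simpa using h1) : 1 ≤ ⌊(t - s) / δ⌋₊)
  have hle : s + n * δ ≤ t := by
    rw [le_div_iff₀ hδ] at hn1
    linarith
  calc μ / (2 * δ) * (t - s) = μ * ((t - s) / δ / 2) := by field_simp
    _ ≤ μ * n := by gcongr; linarith
    _ ≤ f (s + n * δ) - f s := by rw [mul_comm]; exact step n s
    _ ≤ f t - f s := by linarith [hf.mono.monotone hle]

/-- Slopes of a multicritical lift on subintervals are bounded by a multiple of the slope on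
the interval. -/
theorem IsMulticriticalLift.exists_slope_bound {f : ℝ → ℝ} {C : Finset ℝ} {dc : ℝ → ℝ}
    (hf : IsMulticriticalLift f C dc) :
    ∃ K ≥ 1, ∀ s t a b, s ≤ a → a < b → b ≤ t →
      (f b - f a) * (t - s) ≤ K * ((f t - f s) * (b - a)) := by
  have nn : ∀ s t a b, s ≤ a → a < b → b ≤ t → 0 ≤ (f t - f s) * (b - a) := fun s t a b h1 h2 h3 =>
    mul_nonneg (sub_nonneg.2 (hf.1.mono.monotone (by linarith))) (by linarith)
  obtain ⟨δ, hδ, K, hK⟩ := exists_uniform_of_local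
    (R := fun K s t => ∀ a b, s ≤ a → a < b → b ≤ t →
      (f b - f a) * (t - s) ≤ K * ((f t - f s) * (b - a)))
    (fun κ κ' s t hκ h a b h1 h2 h3 =>
      (h a b h1 h2 h3).trans (mul_le_mul_of_nonneg_right hκ (nn s t a b h1 h2 h3)))
    (fun κ s t k h a b h1 h2 h3 => by
      have h4 := h (a - k) (b - k) (by linarith) (by linarith) (by linarith)
      have e1 := hf.1.add_int (a - k) k
      have e2 := hf.1.add_int (b - k) k
      rw [sub_add_cancel] at e1 e2
      rw [hf.1.add_int, hf.1.add_int, e1, e2]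
      convert h4 using 1 <;> ring)
    hf.exists_local_slope_bound
  obtain ⟨S, hS, hSf⟩ := hf.1.exists_slope_upper_bound
  obtain ⟨σ, hσ, hσf⟩ := hf.1.exists_slope_lower_bound hδ
  refine ⟨max 1 (max K (S / σ)), le_max_left _ _, fun s t a b h1 h2 h3 => ?_⟩
  rcases lt_or_ge t (s + δ) with h | h
  · refine (hK s t (by linarith) h a b h1 h2 h3).trans
      (mul_le_mul_of_nonneg_right ?_ (nn s t a b h1 h2 h3))
    exact (le_max_left _ _).trans (le_max_right _ _)
  · have h4 : S / σ ≤ max 1 (max K (S / σ)) := (le_max_right _ _).trans (le_max_right _ _)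
    refine le_trans ?_ (mul_le_mul_of_nonneg_right h4 (nn s t a b h1 h2 h3))
    have hba : 0 < b - a := by linarith
    calc (f b - f a) * (t - s) ≤ S * (b - a) * (t - s) :=
          mul_le_mul_of_nonneg_right (hSf a b h2.le) (by linarith)
      _ = S / σ * (σ * (t - s) * (b - a)) := by field_simp
      _ ≤ S / σ * ((f t - f s) * (b - a)) := by
          have := hσf s t h
          gcongr

end CriticalPoints

section CrossRatioControl

/-- A circle homeomorphism lift whose cross-ratio distortion on an interval is controlled by the
increment of a monotone potential with bounded variation `Λ` over a period. -/
structure IsControlledLift (f Φ : ℝ → ℝ) (Λ : ℝ) : Prop where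
  cont : Continuous f
  mono : StrictMono f
  periodic : ∀ x, f (x + 1) = f x + 1
  pot_mono : Monotone Φ
  pot_periodic : ∀ x, Φ (x + 1) = Φ x + Λ
  crossRatio_le : ∀ a b c d, a < b → b < c → c < d →
    crossRatio (f a) (f b) (f c) (f d) ≤ Real.exp (Φ d - Φ a) * crossRatio a b c d

/-- Length plus twice the number of critical points. -/
def critPotential (C : Finset ℝ) (x : ℝ) : ℝ :=
  x + ∑ c ∈ C, ((⌊x - c⌋ : ℝ) + (⌈x - c⌉ : ℝ))

theorem critPotential_add_int (C : Finset ℝ) (x : ℝ) (k : ℤ) :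
    critPotential C (x + k) = critPotential C x + k * (1 + 2 * C.card) := by
  unfold critPotential
  have : ∀ c ∈ C, ((⌊x + k - c⌋ : ℝ) + (⌈x + k - c⌉ : ℝ)) =
      ((⌊x - c⌋ : ℝ) + (⌈x - c⌉ : ℝ)) + 2 * k := by
    intro c _
    rw [add_sub_right_comm, Int.floor_add_intCast, Int.ceil_add_intCast]
    push_cast
    ring
  rw [Finset.sum_congr rfl this, Finset.sum_add_distrib, Finset.sum_const, nsmul_eq_mul]
  ring

theorem critPotential_term_mono (c : ℝ) {x y : ℝ} (hxy : x ≤ y) :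
    (⌊x - c⌋ : ℝ) + (⌈x - c⌉ : ℝ) ≤ (⌊y - c⌋ : ℝ) + (⌈y - c⌉ : ℝ) := by
  have h1 : ⌊x - c⌋ ≤ ⌊y - c⌋ := Int.floor_mono (by linarith)
  have h2 : ⌈x - c⌉ ≤ ⌈y - c⌉ := Int.ceil_mono (by linarith)
  exact_mod_cast add_le_add h1 h2

theorem sub_le_critPotential_sub (C : Finset ℝ) {x y : ℝ} (hxy : x ≤ y) :
    y - x ≤ critPotential C y - critPotential C x := by
  unfold critPotential
  have := Finset.sum_le_sum fun c (_ : c ∈ C) => critPotential_term_mono c hxy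
  linarith

theorem one_le_critPotential_sub {C : Finset ℝ} {x y c : ℝ} (hc : c ∈ C) (k : ℤ)
    (hx : x ≤ c + k) (hy : c + k ≤ y) (hxy : x < y) :
    1 ≤ critPotential C y - critPotential C x := by
  have term : (⌊x - c⌋ : ℝ) + (⌈x - c⌉ : ℝ) + 1 ≤ (⌊y - c⌋ : ℝ) + (⌈y - c⌉ : ℝ) := by
    have h1 : ⌊x - c⌋ ≤ ⌊y - c⌋ := Int.floor_mono (by linarith)
    have h2 : ⌈x - c⌉ ≤ ⌈y - c⌉ := Int.ceil_mono (by linarith)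
    have : ⌊x - c⌋ + ⌈x - c⌉ + 1 ≤ ⌊y - c⌋ + ⌈y - c⌉ := by
      rcases hx.eq_or_lt with hx | hx
      · have h3 : ⌈x - c⌉ ≤ k := Int.ceil_le.2 (by linarith)
        have h4 : k < ⌈y - c⌉ := Int.lt_ceil.2 (by linarith)
        lia
      · have h3 : ⌊x - c⌋ < k := Int.floor_lt.2 (by linarith)
        have h4 : k ≤ ⌊y - c⌋ := Int.le_floor.2 (by linarith)
        lia
    exact_mod_cast this
  have h := Finset.sum_lt_sum_of_nonempty ⟨c, hc⟩ fun c (_ : c ∈ C) =>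
    lt_add_one ((⌊x - c⌋ : ℝ) + (⌈x - c⌉ : ℝ))
  unfold critPotential
  rw [← Finset.add_sum_erase _ _ hc, ← Finset.add_sum_erase _ _ hc]
  have := Finset.sum_le_sum fun c' (_ : c' ∈ C.erase c) => critPotential_term_mono c' hxy.le
  linarith

theorem crossRatio_le_of_distortion {g : ℝ → ℝ} {p δ κ : ℝ}
    (hg : StrictMonoOn g (Ioo (p - δ) (p + δ))) (hκ : 0 ≤ κ)
    (hdist : ∀ s a b t, p - δ < s → s ≤ a → a < b → b ≤ t → t < p + δ →
        (g b - g a) * (t - s) ≤ Real.exp (κ * (t - s)) * ((g t - g s) * (b - a)))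
    {a b c d : ℝ} (ha : p - δ < a) (hab : a < b) (hbc : b < c) (hcd : c < d) (hd : d < p + δ) :
    crossRatio (g a) (g b) (g c) (g d) ≤ Real.exp (2 * κ * (d - a)) * crossRatio a b c d := by
  have hm : StrictMonoOn g (Icc a d) :=
    hg.mono fun x hx => ⟨by linarith [hx.1], by linarith [hx.2]⟩
  have hac : g a ≤ g c := hm.monotoneOn ⟨le_rfl, by linarith⟩ ⟨by linarith, by linarith⟩
    (by linarith)
  have hbd : g b ≤ g d := hm.monotoneOn ⟨by linarith, by linarith⟩ ⟨by linarith, by linarith⟩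
    (by linarith)
  have h := crossRatio_le_of_slopes (K := Real.exp (κ * (d - a))) hab hbc hcd hm
    ((hdist a a b c ha le_rfl hab hbc.le (by linarith)).trans
      (mul_le_mul_of_nonneg_right
        (Real.exp_le_exp.2 (mul_le_mul_of_nonneg_left (by linarith) hκ))
        (mul_nonneg (by linarith) (by linarith))))
    ((hdist b c d d (by linarith) hbc.le hcd le_rfl hd).trans
      (mul_le_mul_of_nonneg_right
        (Real.exp_le_exp.2 (mul_le_mul_of_nonneg_left (by linarith) hκ))
        (mul_nonneg (by linarith) (by linarith))))
  rwa [← Real.exp_add, show κ * (d - a) + κ * (d - a) = 2 * κ * (d - a) by ring] at h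

/-- The cross-ratio distortion of a multicritical lift is uniformly bounded. -/
theorem IsMulticriticalLift.exists_crossRatio_bound {f : ℝ → ℝ} {C : Finset ℝ} {dc : ℝ → ℝ}
    (hf : IsMulticriticalLift f C dc) :
    ∃ κ ≥ 0, ∀ a b c d, a < b → b < c → c < d →
      crossRatio (f a) (f b) (f c) (f d) ≤ Real.exp κ * crossRatio a b c d := by
  obtain ⟨K, hK, hslope⟩ := hf.exists_slope_bound
  refine ⟨Real.log (K * K), Real.log_nonneg (by nlinarith), fun a b c d hab hbc hcd => ?_⟩
  rw [Real.exp_log (by positivity)]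
  exact crossRatio_le_of_slopes hab hbc hcd (hf.1.mono.strictMonoOn _)
    (hslope a c a b le_rfl hab hbc.le) (hslope b d c d hbc.le hcd le_rfl)

/-- Local control of the cross-ratio distortion of a multicritical lift by the potential. -/
theorem IsMulticriticalLift.exists_local_crossRatio_bound {f : ℝ → ℝ} {C : Finset ℝ}
    {dc : ℝ → ℝ} (hf : IsMulticriticalLift f C dc) (p : ℝ) :
    ∃ δ > 0, ∃ κ, ∀ s t, p - δ < s → s < t → t < p + δ → ∀ b c, s < b → b < c → c < t →
      crossRatio (f s) (f b) (f c) (f t) ≤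
        Real.exp (κ * (critPotential C t - critPotential C s)) * crossRatio s b c t := by
  have weaken : ∀ {κ u s t b c : ℝ}, s < b → b < c → c < t → κ ≤ u →
      crossRatio (f s) (f b) (f c) (f t) ≤ Real.exp κ * crossRatio s b c t →
      crossRatio (f s) (f b) (f c) (f t) ≤ Real.exp u * crossRatio s b c t := by
    intro κ u s t b c h1 h2 h3 hu h
    exact h.trans (mul_le_mul_of_nonneg_right (Real.exp_le_exp.2 hu) (crossRatio_pos h1 h2 h3).le)
  rcases (hf.deriv_nonneg p).eq_or_lt with hp | hp
  · obtain ⟨k₀, hk₀, hglob⟩ := hf.exists_crossRatio_bound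
    obtain ⟨c₀, hc₀, k, hpk⟩ := (hf.2.2.2.1 p).1 hp.symm
    obtain ⟨d, hd, φ, δ₁, hδ₁, h1, h2, h0, hrep⟩ := hf.exists_local_form hp.symm
    obtain ⟨δ₂, hδ₂, κ, hκ, hmono, hdist⟩ := exists_local_distortion h1 h2
    have hδ : 0 < min δ₁ δ₂ := lt_min hδ₁ hδ₂
    have l1 := min_le_left δ₁ δ₂
    have l2 := min_le_right δ₁ δ₂
    refine ⟨min δ₁ δ₂, hδ, max k₀ (2 * κ), ?_⟩
    intro s t hs hst ht b c hsb hbc hct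
    have hlen := sub_le_critPotential_sub C hst.le
    by_cases hmem : s ≤ p ∧ p ≤ t
    · refine weaken hsb hbc hct ?_ (hglob s b c t hsb hbc hct)
      have h3 := one_le_critPotential_sub hc₀ k (hpk ▸ hmem.1) (hpk ▸ hmem.2) hst
      nlinarith [le_max_left k₀ (2 * κ)]
    · have h3 := crossRatio_le_of_distortion hmono hκ hdist (by linarith) hsb hbc hct (by linarith)
      refine weaken hsb hbc hct (κ := 2 * κ * (t - s)) ?_ (le_trans ?_ h3)
      · have := le_max_right k₀ (2 * κ)
        calc 2 * κ * (t - s) ≤ max k₀ (2 * κ) * (t - s) :=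
              mul_le_mul_of_nonneg_right this (by linarith)
          _ ≤ _ := mul_le_mul_of_nonneg_left hlen (by linarith)
      · rw [hrep s ⟨by linarith, by linarith⟩, hrep t ⟨by linarith, by linarith⟩,
          hrep b ⟨by linarith, by linarith⟩, hrep c ⟨by linarith, by linarith⟩]
        have inv := fun x y z w => crossRatio_sub_const x y z w (-f p)
        simp only [sub_neg_eq_add, add_comm _ (f p)] at inv
        rw [inv]
        have mp : p ∈ Ioo (p - δ₂) (p + δ₂) := ⟨by linarith, by linarith⟩
        have ms : s ∈ Ioo (p - δ₂) (p + δ₂) := ⟨by linarith, by linarith⟩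
        have mb : b ∈ Ioo (p - δ₂) (p + δ₂) := ⟨by linarith, by linarith⟩
        have mc : c ∈ Ioo (p - δ₂) (p + δ₂) := ⟨by linarith, by linarith⟩
        have mt : t ∈ Ioo (p - δ₂) (p + δ₂) := ⟨by linarith, by linarith⟩
        rcases lt_or_ge p s with hps | hps
        · exact crossRatio_oddPow_le_of_pos hd.le (h0 ▸ hmono mp ms hps)
            (hmono ms mb hsb) (hmono mb mc hbc) (hmono mc mt hct)
        · have htp : t < p := by
            by_contra! h
            exact hmem ⟨hps, h⟩
          exact crossRatio_oddPow_le_of_neg hd.le (h0 ▸ hmono mt mp htp)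
            (hmono ms mb hsb) (hmono mb mc hbc) (hmono mc mt hct)
  · obtain ⟨δ, hδ, κ, hκ, hmono, hdist⟩ :=
      exists_local_distortion (hf.1.smooth.contDiffAt.of_le (by norm_num)) hp
    refine ⟨δ, hδ, 2 * κ, fun s t hs hst ht b c hsb hbc hct => ?_⟩
    refine weaken hsb hbc hct ?_ (crossRatio_le_of_distortion hmono hκ hdist hs hsb hbc hct ht)
    exact mul_le_mul_of_nonneg_left (sub_le_critPotential_sub C hst.le) (by linarith)

/-- A multicritical lift has controlled cross-ratio distortion. -/
theorem IsMulticriticalLift.exists_isControlledLift {f : ℝ → ℝ} {C : Finset ℝ} {dc : ℝ → ℝ}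
    (hf : IsMulticriticalLift f C dc) : ∃ Φ Λ, IsControlledLift f Φ Λ := by
  have pot_mono : ∀ s t, s ≤ t → 0 ≤ critPotential C t - critPotential C s := fun s t h =>
    le_trans (by linarith) (sub_le_critPotential_sub C h)
  obtain ⟨δ, hδ, κ, hκ⟩ := exists_uniform_of_local
    (R := fun κ s t => ∀ b c, s < b → b < c → c < t →
      crossRatio (f s) (f b) (f c) (f t) ≤
        Real.exp (κ * (critPotential C t - critPotential C s)) * crossRatio s b c t)
    (fun κ κ' s t hκ h b c h1 h2 h3 => (h b c h1 h2 h3).trans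
      (mul_le_mul_of_nonneg_right (Real.exp_le_exp.2
        (mul_le_mul_of_nonneg_right hκ (pot_mono s t (by linarith))))
        (crossRatio_pos h1 h2 h3).le))
    (fun κ s t k h b c h1 h2 h3 => by
      have h4 := h (b - k) (c - k) (by linarith) (by linarith) (by linarith)
      have e1 := hf.1.add_int (b - k) k
      have e2 := hf.1.add_int (c - k) k
      rw [sub_add_cancel] at e1 e2
      have e3 := crossRatio_sub_const (f (s + k)) (f b) (f c) (f (t + k)) k
      have e4 := crossRatio_sub_const (s + k) b c (t + k) k
      rw [hf.1.add_int, hf.1.add_int, e1, e2] at e3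
      simp only [add_sub_cancel_right] at e3 e4
      rw [hf.1.add_int, hf.1.add_int, e1, e2, ← e3, ← e4, critPotential_add_int,
        critPotential_add_int, add_sub_add_right_eq_sub]
      exact h4)
    hf.exists_local_crossRatio_bound
  obtain ⟨k₀, hk₀, hglob⟩ := hf.exists_crossRatio_bound
  have hM : 0 ≤ max κ (k₀ / δ) := le_trans (by positivity) (le_max_right _ _)
  refine ⟨fun x => max κ (k₀ / δ) * critPotential C x,
    max κ (k₀ / δ) * (1 + 2 * C.card), hf.1.smooth.continuous, hf.1.mono, hf.1.periodic, ?_, ?_, ?_⟩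
  · intro x y hxy
    exact mul_le_mul_of_nonneg_left (by linarith [pot_mono x y hxy]) hM
  · intro x
    have := critPotential_add_int C x 1
    push_cast at this
    simp only [this]
    ring
  · intro a b c d hab hbc hcd
    have had : a < d := by linarith
    rw [← mul_sub]
    rcases lt_or_ge d (a + δ) with h | h
    · refine (hκ a d had h b c hab hbc hcd).trans
        (mul_le_mul_of_nonneg_right (Real.exp_le_exp.2 ?_) (crossRatio_pos hab hbc hcd).le)
      exact mul_le_mul_of_nonneg_right (le_max_left _ _) (pot_mono a d had.le)
    · refine (hglob a b c d hab hbc hcd).trans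
        (mul_le_mul_of_nonneg_right (Real.exp_le_exp.2 ?_) (crossRatio_pos hab hbc hcd).le)
      calc k₀ = k₀ / δ * δ := by field_simp
        _ ≤ max κ (k₀ / δ) * (critPotential C d - critPotential C a) :=
          mul_le_mul (le_max_right _ _)
            (le_trans (by linarith) (sub_le_critPotential_sub C had.le)) hδ.le hM

end CrossRatioControl

section CriticalGrowth

theorem abs_oddPow {d : ℝ} (hd : 1 < d) (u : ℝ) : |oddPow d u| = |u| ^ d := by
  have h := Real.rpow_add_of_nonneg (abs_nonneg u) zero_le_one (sub_nonneg.2 hd.le)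
  rw [Real.rpow_one, add_sub_cancel] at h
  rw [oddPow, abs_mul, abs_of_nonneg (Real.rpow_nonneg (abs_nonneg u) (d - 1)), h]

/-- Two-sided power-law growth of a multicritical lift at a critical point. -/
theorem IsMulticriticalLift.exists_growth {f : ℝ → ℝ} {C : Finset ℝ} {dc : ℝ → ℝ}
    (hf : IsMulticriticalLift f C dc) {p : ℝ} (hp : deriv f p = 0) :
    ∃ d : ℝ, 1 < d ∧ ∃ κ > 0, ∃ K > 0, ∀ x, |x - p| ≤ 1 →
      κ * |x - p| ^ d ≤ |f x - f p| ∧ |f x - f p| ≤ K * |x - p| ^ d := by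
  obtain ⟨d, hd, φ, δ₁, hδ₁, h1, h2, h0, hrep⟩ := hf.exists_local_form hp
  obtain ⟨S, hS, hup⟩ := hf.1.exists_slope_upper_bound
  set a := deriv φ p with ha
  have hder : HasDerivAt φ a p := (h1.differentiableAt (by norm_num)).hasDerivAt
  have hloc := (hasDerivAt_iff_isLittleO.1 hder).def (half_pos h2)
  obtain ⟨δ₂, hδ₂, hball⟩ := Metric.eventually_nhds_iff.1 hloc
  set δ := min δ₁ δ₂ with hδ
  have hδpos : 0 < δ := lt_min hδ₁ hδ₂
  obtain ⟨σ, hσ, hlow⟩ := hf.1.exists_slope_lower_bound hδpos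
  have low : ∀ x, δ ≤ |x - p| → σ * |x - p| ≤ |f x - f p| := by
    intro x hx
    rcases le_total p x with h | h
    · have := hlow p x (by rw [abs_of_nonneg (by linarith)] at hx; linarith)
      rw [abs_of_nonneg (by linarith), abs_of_nonneg (by linarith [hf.1.mono.monotone h])]
      exact this
    · have := hlow x p (by rw [abs_of_nonpos (by linarith)] at hx; linarith)
      rw [abs_of_nonpos (by linarith), abs_of_nonpos (by linarith [hf.1.mono.monotone h])]
      linarith
  have up : ∀ x, |f x - f p| ≤ S * |x - p| := by
    intro x
    rcases le_total p x with h | h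
    · rw [abs_of_nonneg (by linarith [hf.1.mono.monotone h]), abs_of_nonneg (by linarith)]
      exact hup p x h
    · rw [abs_of_nonpos (by linarith [hf.1.mono.monotone h]), abs_of_nonpos (by linarith)]
      linarith [hup x p h]
  have hdp : 0 < δ ^ (d - 1) := Real.rpow_pos_of_pos hδpos _
  refine ⟨d, hd, min σ ((a / 2) ^ d), lt_min hσ (Real.rpow_pos_of_pos (by linarith) _),
    max (S / δ ^ (d - 1)) ((3 * a / 2) ^ d), lt_max_of_lt_left (by positivity), ?_⟩
  intro x hx
  have hxn : 0 ≤ |x - p| := abs_nonneg _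
  have hpn : 0 ≤ |x - p| ^ d := Real.rpow_nonneg hxn _
  rcases lt_or_ge |x - p| δ with hxδ | hxδ
  · have hxδ₁ : |x - p| < δ₁ := hxδ.trans_le (min_le_left _ _)
    have hxδ₂ : |x - p| < δ₂ := hxδ.trans_le (min_le_right _ _)
    rw [abs_lt] at hxδ₁
    have hφ := hball (y := x) hxδ₂
    rw [h0, sub_zero, smul_eq_mul, Real.norm_eq_abs, Real.norm_eq_abs] at hφ
    have hmul : |(x - p) * a| = a * |x - p| := by rw [abs_mul, abs_of_pos h2, mul_comm]
    have l1 : a / 2 * |x - p| ≤ |φ x| := by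
      have := abs_sub_abs_le_abs_sub ((x - p) * a) (φ x)
      rw [abs_sub_comm] at this
      linarith
    have l2 : |φ x| ≤ 3 * a / 2 * |x - p| := by
      have := abs_sub_abs_le_abs_sub (φ x) ((x - p) * a)
      linarith
    rw [hrep x ⟨by linarith, by linarith⟩, add_sub_cancel_left, abs_oddPow hd]
    constructor
    · calc _ ≤ (a / 2) ^ d * |x - p| ^ d := mul_le_mul_of_nonneg_right (min_le_right _ _) hpn
        _ = (a / 2 * |x - p|) ^ d := (Real.mul_rpow (by linarith) hxn).symm
        _ ≤ _ := Real.rpow_le_rpow (by positivity) l1 (by linarith)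
    · calc |φ x| ^ d ≤ (3 * a / 2 * |x - p|) ^ d :=
            Real.rpow_le_rpow (abs_nonneg _) l2 (by linarith)
        _ = (3 * a / 2) ^ d * |x - p| ^ d := Real.mul_rpow (by linarith) hxn
        _ ≤ _ := mul_le_mul_of_nonneg_right (le_max_right _ _) hpn
  · have split : |x - p| ^ d = |x - p| * |x - p| ^ (d - 1) := by
      have h := Real.rpow_add_of_nonneg hxn zero_le_one (sub_nonneg.2 hd.le)
      rwa [Real.rpow_one, add_sub_cancel] at h
    have le1 : |x - p| ^ (d - 1) ≤ 1 := Real.rpow_le_one hxn hx (by linarith)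
    have ge1 : δ ^ (d - 1) ≤ |x - p| ^ (d - 1) :=
      Real.rpow_le_rpow hδpos.le hxδ (by linarith)
    constructor
    · calc _ ≤ σ * |x - p| ^ d := mul_le_mul_of_nonneg_right (min_le_left _ _) hpn
        _ ≤ σ * |x - p| := mul_le_mul_of_nonneg_left
            (split ▸ mul_le_of_le_one_right hxn le1) hσ.le
        _ ≤ _ := low x hxδ
    · calc _ ≤ S * |x - p| := up x
        _ = S / δ ^ (d - 1) * (|x - p| * δ ^ (d - 1)) := by field_simp
        _ ≤ S / δ ^ (d - 1) * |x - p| ^ d := mul_le_mul_of_nonneg_left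
            (split ▸ mul_le_mul_of_nonneg_left ge1 hxn) (by positivity)
        _ ≤ _ := mul_le_mul_of_nonneg_right (le_max_left _ _) hpn

end CriticalGrowth

section Returns

/-- The `q`-th iterate composed with the translation by `-p`. -/
def ret (f : ℝ → ℝ) (q : ℕ) (p : ℤ) (y : ℝ) : ℝ := f^[q] y - p

theorem iterate_add_int {f : ℝ → ℝ} (hf : ∀ x, f (x + 1) = f x + 1) (n : ℕ) (x : ℝ) (k : ℤ) :
    f^[n] (x + k) = f^[n] x + k := by
  induction n generalizing x with
  | zero => rfl
  | succ n ih =>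
    rw [Function.iterate_succ_apply, Function.iterate_succ_apply, add_int_of_add_one hf, mul_one,
      ih]

theorem iterate_sub_int {f : ℝ → ℝ} (hf : ∀ x, f (x + 1) = f x + 1) (n : ℕ) (x : ℝ) (k : ℤ) :
    f^[n] (x - k) = f^[n] x - k := by
  have := iterate_add_int hf n x (-k)
  push_cast at this
  simpa only [sub_eq_add_neg] using this

theorem iterate_ret {f : ℝ → ℝ} (hf : ∀ x, f (x + 1) = f x + 1) (m q : ℕ) (p : ℤ) (x : ℝ) :
    f^[m] (ret f q p x) = ret f q p (f^[m] x) := by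
  rw [ret, ret, iterate_sub_int hf, ← Function.iterate_add_apply, ← Function.iterate_add_apply,
    add_comm]

theorem ret_add_int {f : ℝ → ℝ} (hf : ∀ x, f (x + 1) = f x + 1) (q : ℕ) (p : ℤ) (x : ℝ) (k : ℤ) :
    ret f q p (x + k) = ret f q p x + k := by
  rw [ret, ret, iterate_add_int hf]
  ring

theorem ret_comm {f : ℝ → ℝ} (hf : ∀ x, f (x + 1) = f x + 1) (q Q : ℕ) (p P : ℤ) (x : ℝ) :
    ret f Q P (ret f q p x) = ret f q p (ret f Q P x) := by
  rw [ret, iterate_ret hf]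
  simp only [ret]
  rw [iterate_sub_int hf]
  ring

theorem strictMono_ret {f : ℝ → ℝ} (hf : StrictMono f) (q : ℕ) (p : ℤ) :
    StrictMono (ret f q p) := fun _ _ h => sub_lt_sub_right (hf.iterate q h) _

theorem sum_shift_sub_comm (u : ℕ → ℝ) (q Q : ℕ) :
    ∑ i ∈ Finset.range Q, (u (i + q) - u i) = ∑ i ∈ Finset.range q, (u (i + Q) - u i) := by
  have h1 := Finset.sum_range_add u q Q
  have h2 := Finset.sum_range_add u Q q
  rw [add_comm Q q] at h2
  have e1 : ∀ i, u (i + q) = u (q + i) := fun i => by rw [add_comm]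
  have e2 : ∀ i, u (i + Q) = u (Q + i) := fun i => by rw [add_comm]
  simp only [Finset.sum_sub_distrib, e1, e2]
  linarith

/-- Two consecutive closest return times `q ≤ Q` of a degree one lift, the first moving points to
the right and the second to the left. -/
structure IsReturnPair (f : ℝ → ℝ) (q Q : ℕ) (p P : ℤ) : Prop where
  le : q ≤ Q
  det : (q : ℤ) * P - Q * p = 1
  lt_ret : ∀ y, y < ret f q p y
  ret_lt_add_one : ∀ y, ret f q p y < y + 1
  ret_lt : ∀ y, ret f Q P y < y
  lt_ret_ret : ∀ y, y < ret f q p (ret f Q P y)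

variable {f : ℝ → ℝ} {q Q : ℕ} {p P : ℤ}

theorem IsReturnPair.sum_sub_add_sum_sub (hpair : IsReturnPair f q Q p P) {Ψ : ℝ → ℝ} {Λ : ℝ}
    (hΨ : ∀ x, Ψ (x + 1) = Ψ x + Λ) (x : ℝ) :
    ∑ i ∈ Finset.range Q, (Ψ (ret f q p (f^[i] x)) - Ψ (f^[i] x)) +
      ∑ i ∈ Finset.range q, (Ψ (f^[i] x) - Ψ (ret f Q P (f^[i] x))) = Λ := by
  have e : ∀ (r : ℕ) (s : ℤ) (i : ℕ),
      Ψ (ret f r s (f^[i] x)) = Ψ (f^[i + r] x) - s * Λ := by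
    intro r s i
    have := add_int_of_add_one hΨ (f^[i + r] x) (-s)
    rw [ret, ← Function.iterate_add_apply, add_comm r i, sub_eq_add_neg]
    push_cast at this
    rw [this]
    ring
  have h := sum_shift_sub_comm (fun i => Ψ (f^[i] x)) q Q
  simp only [e, Finset.sum_sub_distrib, Finset.sum_const, Finset.card_range, nsmul_eq_mul] at *
  have hd : (q : ℝ) * P - Q * p = 1 := by exact_mod_cast hpair.det
  linear_combination h + Λ * hd

theorem IsReturnPair.sum_ret_sub_le (hpair : IsReturnPair f q Q p P) {Ψ : ℝ → ℝ} {Λ : ℝ}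
    (hmono : Monotone Ψ) (hΨ : ∀ x, Ψ (x + 1) = Ψ x + Λ) (x : ℝ) :
    ∑ i ∈ Finset.range Q, (Ψ (ret f q p (f^[i] x)) - Ψ (f^[i] x)) ≤ Λ := by
  have h := hpair.sum_sub_add_sum_sub hΨ x
  have h2 : 0 ≤ ∑ i ∈ Finset.range q, (Ψ (f^[i] x) - Ψ (ret f Q P (f^[i] x))) :=
    Finset.sum_nonneg fun i _ => sub_nonneg.2 (hmono (hpair.ret_lt _).le)
  linarith

theorem IsReturnPair.exists_cover (hpair : IsReturnPair f q Q p P)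
    (hper : ∀ x, f (x + 1) = f x + 1) (w x : ℝ) :
    ∃ i < q + Q, ∃ l : ℤ, f^[i] w + l ≤ x ∧ x ≤ ret f q p (f^[i] w + l) := by
  have hΨ : ∀ y : ℝ, (fun y : ℝ => (⌊y - x⌋ : ℝ)) (y + 1) = (fun y : ℝ => (⌊y - x⌋ : ℝ)) y + 1 := by
    intro y
    have : y + 1 - x = y - x + 1 := by ring
    simp only [this, Int.floor_add_one]
    push_cast
    rfl
  have h := hpair.sum_sub_add_sum_sub (Ψ := fun y : ℝ => (⌊y - x⌋ : ℝ)) hΨ w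
  by_contra! hno
  have h1 : ∑ i ∈ Finset.range Q,
      ((⌊ret f q p (f^[i] w) - x⌋ : ℝ) - (⌊f^[i] w - x⌋ : ℝ)) ≤ 0 := by
    refine Finset.sum_nonpos fun i hi => ?_
    by_contra! hlt
    have hlt : ⌊f^[i] w - x⌋ < ⌊ret f q p (f^[i] w) - x⌋ := by
      have := sub_pos.1 hlt
      exact_mod_cast this
    have a1 := Int.floor_lt.1 hlt
    have a2 := Int.floor_le (ret f q p (f^[i] w) - x)
    have := hno i (by have := Finset.mem_range.1 hi; lia) (-⌊ret f q p (f^[i] w) - x⌋)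
      (by push_cast; linarith)
    rw [ret_add_int hper] at this
    push_cast at this
    linarith
  have h2 : ∑ i ∈ Finset.range q,
      ((⌊f^[i] w - x⌋ : ℝ) - (⌊ret f Q P (f^[i] w) - x⌋ : ℝ)) ≤ 0 := by
    refine Finset.sum_nonpos fun i hi => ?_
    by_contra! hlt
    have hlt : ⌊ret f Q P (f^[i] w) - x⌋ < ⌊f^[i] w - x⌋ := by
      have := sub_pos.1 hlt
      exact_mod_cast this
    have a1 := Int.floor_lt.1 hlt
    have a2 := Int.floor_le (f^[i] w - x)
    have e : f^[i + Q] w + (-P - ⌊f^[i] w - x⌋ : ℤ) = ret f Q P (f^[i] w) + (-⌊f^[i] w - x⌋ : ℤ) := by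
      rw [ret, ← Function.iterate_add_apply, add_comm i Q]
      push_cast
      ring
    have := hno (i + Q) (by have := Finset.mem_range.1 hi; lia) (-P - ⌊f^[i] w - x⌋)
      (by rw [e]; push_cast; linarith)
    rw [e, ret_add_int hper] at this
    push_cast at this
    linarith [hpair.lt_ret_ret (f^[i] w)]
  linarith

theorem IsReturnPair.sum_iterate_ret_sub_le (hpair : IsReturnPair f q Q p P)
    (hper : ∀ x, f (x + 1) = f x + 1) {Ψ : ℝ → ℝ} {Λ : ℝ}
    (hmono : Monotone Ψ) (hΨ : ∀ x, Ψ (x + 1) = Ψ x + Λ) (k : ℕ) (x : ℝ) :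
    ∑ i ∈ Finset.range Q, (Ψ (f^[i] ((ret f q p)^[k] x)) - Ψ (f^[i] x)) ≤ k * Λ := by
  induction k with
  | zero => simp
  | succ k ih =>
    have h := hpair.sum_ret_sub_le hmono hΨ ((ret f q p)^[k] x)
    simp only [Function.iterate_succ_apply', iterate_ret hper] at ih ⊢
    simp only [Finset.sum_sub_distrib] at *
    push_cast
    linarith

theorem IsReturnPair.sum_sub_le (hpair : IsReturnPair f q Q p P)
    (hper : ∀ x, f (x + 1) = f x + 1) (hfm : StrictMono f) {Ψ : ℝ → ℝ} {Λ : ℝ}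
    (hmono : Monotone Ψ) (hΨ : ∀ x, Ψ (x + 1) = Ψ x + Λ) {N k m : ℕ} {a d : ℝ} (had : a ≤ d)
    (hd : d ≤ (ret f q p)^[k] a) (hm : m ≤ N * Q) :
    ∑ i ∈ Finset.range m, (Ψ (f^[i] d) - Ψ (f^[i] a)) ≤ N * (k * Λ) := by
  have hnn : ∀ i, 0 ≤ Ψ (f^[i] d) - Ψ (f^[i] a) := fun i =>
    sub_nonneg.2 (hmono ((hfm.iterate i).monotone had))
  refine (Finset.sum_le_sum_of_subset_of_nonneg (Finset.range_mono hm) fun i _ _ => hnn i).trans ?_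
  clear hm hnn
  induction N with
  | zero => simp
  | succ N ih =>
    rw [Nat.succ_mul, Finset.sum_range_add]
    have h := hpair.sum_iterate_ret_sub_le hper hmono hΨ k (f^[N * Q] a)
    have h2 : ∑ i ∈ Finset.range Q, (Ψ (f^[N * Q + i] d) - Ψ (f^[N * Q + i] a)) ≤
        ∑ i ∈ Finset.range Q,
          (Ψ (f^[i] ((ret f q p)^[k] (f^[N * Q] a))) - Ψ (f^[i] (f^[N * Q] a))) := by
      refine Finset.sum_le_sum fun i _ => ?_
      have comm : ∀ j y, f^[N * Q] ((ret f q p)^[j] y) = (ret f q p)^[j] (f^[N * Q] y) := by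
        intro j y
        exact ((Function.Commute.iterate_right
          (fun y => iterate_ret hper (N * Q) q p y) j) y)
      rw [add_comm (N * Q) i, Function.iterate_add_apply, Function.iterate_add_apply, ← comm]
      exact sub_le_sub_right (hmono ((hfm.iterate _).monotone ((hfm.iterate _).monotone hd))) _
    push_cast
    linarith

theorem IsControlledLift.crossRatio_iterate_le {Φ : ℝ → ℝ} {Λ : ℝ} (hf : IsControlledLift f Φ Λ)
    {a b c d : ℝ} (hab : a < b) (hbc : b < c) (hcd : c < d) (m : ℕ) :
    crossRatio (f^[m] a) (f^[m] b) (f^[m] c) (f^[m] d) ≤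
      Real.exp (∑ i ∈ Finset.range m, (Φ (f^[i] d) - Φ (f^[i] a))) * crossRatio a b c d := by
  induction m with
  | zero => simp
  | succ m ih =>
    have h := hf.crossRatio_le _ _ _ _ (hf.mono.iterate m hab) (hf.mono.iterate m hbc)
      (hf.mono.iterate m hcd)
    rw [Finset.sum_range_succ, Real.exp_add, mul_comm (Real.exp _), mul_assoc]
    simp only [Function.iterate_succ_apply']
    exact h.trans (mul_le_mul_of_nonneg_left ih (Real.exp_pos _).le)

theorem IsReturnPair.crossRatio_iterate_le (hpair : IsReturnPair f q Q p P) {Φ : ℝ → ℝ} {Λ : ℝ}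
    (hf : IsControlledLift f Φ Λ) {N k m : ℕ} {a b c d : ℝ} (hab : a < b) (hbc : b < c)
    (hcd : c < d) (hd : d ≤ (ret f q p)^[k] a) (hm : m ≤ N * Q) :
    crossRatio (f^[m] a) (f^[m] b) (f^[m] c) (f^[m] d) ≤
      Real.exp (N * (k * Λ)) * crossRatio a b c d :=
  (hf.crossRatio_iterate_le hab hbc hcd m).trans (mul_le_mul_of_nonneg_right
    (Real.exp_le_exp.2 (hpair.sum_sub_le hf.periodic hf.mono hf.pot_mono hf.pot_periodic
      (by linarith) hd hm)) (crossRatio_pos hab hbc hcd).le)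

end Returns

section RealBounds

variable {f : ℝ → ℝ} {Φ : ℝ → ℝ} {Λ : ℝ} {q Q : ℕ} {p P : ℤ}

theorem surjective_of_add_one {f : ℝ → ℝ} (hc : Continuous f) (hf : ∀ x, f (x + 1) = f x + 1) :
    Function.Surjective f := by
  intro y
  have h := fun k : ℤ => add_int_of_add_one hf 0 k
  simp only [zero_add, mul_one] at h
  have h1 := Int.le_ceil (y - f 0)
  have h2 := Int.ceil_lt_add_one (y - f 0)
  have e := h (⌈y - f 0⌉ - 1)
  push_cast at e
  obtain ⟨x, -, hx⟩ := intermediate_value_Icc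
    (show (⌈y - f 0⌉ : ℝ) - 1 ≤ ⌈y - f 0⌉ by linarith) hc.continuousOn
    (show y ∈ Icc (f (⌈y - f 0⌉ - 1)) (f ⌈y - f 0⌉) by
      rw [e, h]
      constructor <;> linarith)
  exact ⟨x, hx⟩

/-- If an iterate of a configuration of four points has definite space around its middle interval,
then the configuration itself has definite space around its middle interval. -/
theorem IsReturnPair.middle_le (hpair : IsReturnPair f q Q p P) (hf : IsControlledLift f Φ Λ)
    {N k m : ℕ} {a b c d M M' : ℝ} (hab : a < b) (hbc : b < c)
    (hcd : c < d) (hd : d ≤ (ret f q p)^[k] a) (hm : m ≤ N * Q) (hM : 0 < M) (hM' : 0 < M')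
    (hL : f^[m] c - f^[m] b ≤ M * (f^[m] b - f^[m] a))
    (hR : f^[m] c - f^[m] b ≤ M' * (f^[m] d - f^[m] c)) :
    c - b ≤ (1 + M) * (1 + M') * Real.exp (N * (k * Λ)) * (b - a) ∧
      c - b ≤ (1 + M) * (1 + M') * Real.exp (N * (k * Λ)) * (d - c) := by
  have h1 := hpair.crossRatio_iterate_le hf hab hbc hcd hd hm
  have h2 := le_crossRatio_of_gaps (s := M⁻¹) (t := M'⁻¹) (hf.mono.iterate m hbc)
    (inv_pos.2 hM) (inv_pos.2 hM') ((inv_mul_le_iff₀ hM).2 hL) ((inv_mul_le_iff₀ hM').2 hR)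
  have e : ∀ x : ℝ, 0 < x → x⁻¹ / (1 + x⁻¹) = (1 + x)⁻¹ := by
    intro x hx
    field_simp
    ring
  rw [e M hM, e M' hM', ← mul_inv] at h2
  have hpos : 0 < (1 + M) * (1 + M') := by positivity
  have key : ∀ r : ℝ, crossRatio a b c d ≤ r / (c - b) →
      c - b ≤ (1 + M) * (1 + M') * Real.exp (N * (k * Λ)) * r := by
    intro r hr
    have h3 := h2.trans (h1.trans (mul_le_mul_of_nonneg_left hr (Real.exp_pos _).le))
    rw [← mul_div_assoc, le_div_iff₀ (sub_pos.2 hbc), inv_mul_le_iff₀ hpos, ← mul_assoc] at h3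
    exact h3
  exact ⟨key _ (crossRatio_le_left hab hbc hcd), key _ (crossRatio_le_right hab hbc hcd)⟩

theorem IsControlledLift.surjective_ret (hf : IsControlledLift f Φ Λ) (q : ℕ) (p : ℤ) :
    Function.Surjective (ret f q p) :=
  surjective_of_add_one ((hf.cont.iterate q).sub continuous_const) fun x => by
    have := ret_add_int hf.periodic q p x 1
    push_cast at this
    exact this

/-- Points which reach a minimal displacement of the return map have definite space. -/
theorem IsReturnPair.ret_gap_le_of_minimal (hpair : IsReturnPair f q Q p P)
    (hf : IsControlledLift f Φ Λ) {z v : ℝ} {m : ℕ} {l : ℤ}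
    (hz : ∀ y, ret f q p z - z ≤ ret f q p y - y) (hm : m ≤ 5 * Q) (hv : f^[m] v = z + l) :
    ret f q p v - v ≤ 4 * Real.exp (15 * Λ) * (ret f q p (ret f q p v) - ret f q p v) := by
  obtain ⟨u, rfl⟩ := hf.surjective_ret q p v
  have h := (hpair.middle_le hf (N := 5) (k := 3) (M := 1) (M' := 1) (hpair.lt_ret u)
    (hpair.lt_ret _) (hpair.lt_ret _) le_rfl hm one_pos one_pos ?_ ?_).2
  · convert h using 2
    push_cast
    ring_nf
  all_goals
    simp only [iterate_ret hf.periodic _ q p] at hv ⊢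
    rw [hv, ret_add_int hf.periodic, one_mul, add_sub_add_right_eq_sub]
  · have := hz (f^[m] u)
    rwa [hv] at this
  · have := hz (ret f q p (z + l))
    rwa [ret_add_int hf.periodic] at this

set_option maxHeartbeats 400000 in
/-- Real bounds: consecutive displacements of a return map are comparable, uniformly in the
point and in the return map. -/
theorem exists_ret_gap_le (Λ : ℝ) : ∃ A ≥ 1, ∀ (f Φ : ℝ → ℝ) (q Q : ℕ) (p P : ℤ),
    IsControlledLift f Φ Λ → IsReturnPair f q Q p P →
    ∀ x, ret f q p x - x ≤ A * (ret f q p (ret f q p x) - ret f q p x) := by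
  set E : ℝ := 4 * Real.exp (15 * Λ) with hE
  have hEpos : 0 < E := by positivity
  set D : ℝ := (1 + (E + 1) ^ 2) * (1 + (E + 1) ^ 2) * Real.exp (15 * Λ) with hD
  have hDpos : 0 < D := by positivity
  refine ⟨(E + 1) * (D + 1), by nlinarith [mul_pos hEpos hDpos], ?_⟩
  intro f Φ q Q p P hf hpair x
  set g := ret f q p with hg
  have hper := hf.periodic
  have hgm : StrictMono g := strictMono_ret hf.mono q p
  have hgi : ∀ (y : ℝ) (k : ℤ), g (y + k) = g y + k := ret_add_int hper q p
  have hit : ∀ m y, f^[m] (g y) = g (f^[m] y) := fun m y => iterate_ret hper m q p y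
  obtain ⟨z, hz⟩ := exists_min_of_periodic (u := fun y => g y - y)
    (((hf.cont.iterate q).sub continuous_const).sub continuous_id) fun y => by
      have := hgi y 1
      push_cast at this
      simp only [this]
      ring
  have hlpos : 0 < g z - z := sub_pos.2 (hpair.lt_ret z)
  set ℓ := g z - z with hℓ
  obtain ⟨w, hw⟩ := (surjective_of_add_one hf.cont hper).iterate (5 * Q) z
  obtain ⟨i, hi, l, hux, hxu⟩ := hpair.exists_cover hper w x
  have hqQ := hpair.le
  set u := f^[i] w + (l : ℝ) with hu
  have hzu : f^[5 * Q - i] u = z + l := by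
    rw [hu, iterate_add_int hper, ← Function.iterate_add_apply, Nat.sub_add_cancel (by lia), hw]
  have step : ∀ {m : ℕ} {y : ℝ} {k : ℤ}, q ≤ m → f^[m] y = z + k →
      f^[m - q] (g y) = z + (k - p : ℤ) := by
    intro m y k hqm hy
    rw [hg, ret, iterate_sub_int hper, ← Function.iterate_add_apply, Nat.sub_add_cancel hqm, hy]
    push_cast
    ring
  have good : ∀ {m : ℕ} {y : ℝ} {k : ℤ}, m ≤ 5 * Q → f^[m] y = z + k →
      g y - y ≤ E * (g (g y) - g y) :=
    fun hm hy => hpair.ret_gap_le_of_minimal hf hz hm hy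
  have gap_eq : ∀ {y : ℝ} {k : ℤ}, y = z + k → g y - y = ℓ := by
    intro y k hy
    rw [hy, hgi, add_sub_add_right_eq_sub]
  have hzv := step (by lia) hzu
  have hzv1 := step (by lia) hzv
  have hzv2 := step (by lia) hzv1
  set v := g u with hv
  set m := 5 * Q - i - q - q - q with hm
  have gap2 : g (g (f^[m] (g v))) - g (f^[m] (g v)) = ℓ := by
    rw [← hit]
    exact gap_eq hzv2
  have gap1 : g (f^[m] (g v)) - f^[m] (g v) ≤ E * ℓ := by
    have h := good (m := q) (y := f^[m] (g v)) (k := l - p - p - p + p) (by lia) (by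
      rw [← Function.iterate_add_apply, add_comm, Nat.sub_add_cancel (by lia), hzv1]
      push_cast
      ring)
    rwa [gap2] at h
  have gap0 : f^[m] (g v) - f^[m] v ≤ E * (E * ℓ) := by
    have h := good (m := q + q) (y := f^[m] v) (k := l - p) (by lia) (by
      rw [← Function.iterate_add_apply, add_comm, ← add_assoc, Nat.sub_add_cancel (by lia),
        Nat.sub_add_cancel (by lia), hzv])
    rw [← hit] at h
    exact h.trans (mul_le_mul_of_nonneg_left gap1 hEpos.le)
  have hvx : v ≤ g x := hgm.monotone hux
  have hxv : g x ≤ g v := hgm.monotone hxu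
  have hfm := (hf.mono.iterate m).monotone
  have hE1 : E ≤ (E + 1) ^ 2 := by nlinarith
  have hE2 : E * E ≤ (E + 1) ^ 2 := by nlinarith
  have hm5 : m ≤ 5 * Q := by lia
  have hDpush : (1 + (E + 1) ^ 2) * (1 + (E + 1) ^ 2) *
      Real.exp ((5 : ℕ) * ((3 : ℕ) * Λ)) = D := by
    rw [hD]
    push_cast
    ring_nf
  have sq_pos : 0 < (E + 1) ^ 2 := by positivity
  have bound : ∀ y, (E + 1) ^ 2 * ℓ ≤ (E + 1) ^ 2 * (g y - y) := fun y =>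
    mul_le_mul_of_nonneg_left (hz y) sq_pos.le
  have gx_pos : 0 < g (g x) - g x := sub_pos.2 (hpair.lt_ret _)
  have left : g x - v ≤ D * (g (g x) - g x) := by
    rcases hvx.eq_or_lt with h | h
    · rw [h, sub_self]
      positivity
    · have h3 := (hpair.middle_le hf (N := 5) (k := 3) (m := m) (a := u) (b := v) (c := g x)
        (d := g (g x)) (hpair.lt_ret u) h (hpair.lt_ret _) (hgm.monotone (hgm.monotone hxu)) hm5
        sq_pos sq_pos ?_ ?_).2
      · rwa [hDpush] at h3
      all_goals
        have h4 : f^[m] (g x) - f^[m] v ≤ (E + 1) ^ 2 * ℓ := by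
          nlinarith [hfm hxv, mul_le_mul_of_nonneg_right hE2 hlpos.le]
        refine h4.trans ?_
        rw [hit]
        exact bound _
  have h1 := good (by lia) hzu
  have h2 : x - u ≥ 0 := sub_nonneg.2 hux
  have h3 : g v ≤ g (g x) := hgm.monotone hvx
  calc g x - x ≤ (v - u) + (g v - v) := by linarith
    _ ≤ (E + 1) * (g v - v) := by linarith
    _ ≤ (E + 1) * ((D + 1) * (g (g x) - g x)) :=
      mul_le_mul_of_nonneg_left (by linarith) (by linarith)
    _ = _ := by ring

end RealBounds

section Space

variable {f : ℝ → ℝ} {Φ : ℝ → ℝ} {Λ : ℝ} {q Q : ℕ} {p P : ℤ}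

theorem IsReturnPair.pos (hpair : IsReturnPair f q Q p P) : 0 < Q := by
  have h1 := hpair.le
  have h2 := hpair.det
  by_contra! h
  obtain rfl : Q = 0 := by lia
  obtain rfl : q = 0 := by lia
  simp at h2

/-- The four points `h x < x < g x < g (g x)` lie in three fundamental domains of `g`. -/
theorem IsReturnPair.ret_ret_le (hpair : IsReturnPair f q Q p P) (hf : StrictMono f) (x : ℝ) :
    ret f q p (ret f q p x) ≤ (ret f q p)^[3] (ret f Q P x) :=
  ((strictMono_ret hf q p).comp (strictMono_ret hf q p)).monotone (hpair.lt_ret_ret x).le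

/-- At a point where the lift has power-law growth, consecutive closest returns are comparable. -/
theorem IsReturnPair.ret_sub_le_of_growth (hpair : IsReturnPair f q Q p P)
    (hf : IsControlledLift f Φ Λ) {x d κ K A : ℝ} (hd : 1 < d) (hκ : 0 < κ) (hK : 0 < K)
    (hA : 1 ≤ A)
    (hgrow : ∀ y, |y - x| ≤ 1 →
      κ * |y - x| ^ d ≤ |f y - f x| ∧ |f y - f x| ≤ K * |y - x| ^ d)
    (hg : ∀ y, ret f q p y - y ≤ A * (ret f q p (ret f q p y) - ret f q p y))
    (hh : ∀ y, y - ret f Q P y ≤ A * (ret f Q P y - ret f Q P (ret f Q P y))) :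
    ret f q p x - x ≤
      max 1 ((3 * A * (1 + A) * Real.exp (3 * Λ) * K / κ) ^ (d - 1)⁻¹) * (x - ret f Q P x) := by
  have hmid := fun M hM => hpair.middle_le hf (N := 1) (k := 3) (m := Q - 1) (M := M) (M' := A)
    (hf.mono (hpair.ret_lt x)) (hf.mono (hpair.lt_ret x)) (hf.mono (hpair.lt_ret (ret f q p x)))
    (by
      have h := hf.mono.monotone (hpair.ret_ret_le hf.mono x)
      have comm : ∀ j y, f ((ret f q p)^[j] y) = (ret f q p)^[j] (f y) := fun j y =>
        (Function.Commute.iterate_right (fun y => iterate_ret hf.periodic 1 q p y) j) y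
      rwa [comm] at h)
    (by lia) hM (by linarith)
  have hQ : ∀ y, f^[Q - 1] (f y) = ret f Q P y + P := fun y => by
    rw [← Function.iterate_succ_apply, Nat.succ_eq_add_one, Nat.sub_add_cancel hpair.pos, ret,
      sub_add_cancel]
  simp only [hQ, add_sub_add_right_eq_sub, ret_comm hf.periodic q Q p P] at hmid
  have ht1 : ret f q p x - x ≤ 1 := by linarith [hpair.ret_lt_add_one x]
  have gt := hgrow (ret f q p x)
  have gε := hgrow (ret f Q P x)
  have hεpos : 0 < x - ret f Q P x := sub_pos.2 (hpair.ret_lt x)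
  have htpos : 0 < ret f q p x - x := sub_pos.2 (hpair.lt_ret x)
  rw [abs_of_pos htpos, abs_of_pos (sub_pos.2 (hf.mono (hpair.lt_ret x)))] at gt
  rw [abs_sub_comm, abs_of_pos hεpos, abs_sub_comm,
    abs_of_pos (sub_pos.2 (hf.mono (hpair.ret_lt x)))] at gε
  have hgh : ret f q p (ret f Q P x) - ret f Q P x ≤ (ret f q p x - x) + (x - ret f Q P x) := by
    have := strictMono_ret hf.mono q p (hpair.ret_lt x)
    linarith
  have hhx := hh x
  have hghx := hg (ret f Q P x)
  set t := ret f q p x - x with ht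
  set ε := x - ret f Q P x with hε
  rcases le_or_gt t ε with hle | hlt
  · exact hle.trans (le_mul_of_one_le_left hεpos.le (le_max_left _ _))
  · set s := t / ε with hs
    have hts : t = s * ε := by rw [hs, div_mul_cancel₀ _ hεpos.ne']
    have hs1 : 1 ≤ s := (one_le_div hεpos).2 hlt.le
    have h := (hmid (2 * s * A) (by positivity) ?_ hghx).1
    · have h1 := (gt ht1).1.trans (h.trans (mul_le_mul_of_nonneg_left (gε (by linarith)).2
        (by positivity)))
      rw [hts, Real.mul_rpow (by positivity) hεpos.le] at h1
      have hεd : 0 < ε ^ d := Real.rpow_pos_of_pos hεpos d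
      have split : s ^ d = s * s ^ (d - 1) := by
        have h := Real.rpow_add_of_nonneg (by linarith : (0 : ℝ) ≤ s) zero_le_one
          (sub_nonneg.2 hd.le)
        rwa [Real.rpow_one, add_sub_cancel] at h
      have h2 : s ^ (d - 1) ≤ 3 * A * (1 + A) * Real.exp (3 * Λ) * K / κ := by
        rw [le_div_iff₀ hκ]
        have h3 : 1 + 2 * s * A ≤ 3 * s * A := by nlinarith
        have h4 : (κ * s ^ (d - 1)) * (s * ε ^ d) ≤
            (3 * A * (1 + A) * Real.exp (3 * Λ) * K) * (s * ε ^ d) := by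
          calc _ = κ * (s ^ d * ε ^ d) := by rw [split]; ring
            _ ≤ _ := h1
            _ ≤ (3 * s * A) * (1 + A) * Real.exp ((1 : ℕ) * ((3 : ℕ) * Λ)) * (K * ε ^ d) := by
              gcongr
            _ = _ := by
              push_cast
              rw [one_mul]
              ring
        rw [mul_comm]
        exact le_of_mul_le_mul_right h4 (by positivity)
      have h5 : s ≤ (3 * A * (1 + A) * Real.exp (3 * Λ) * K / κ) ^ (d - 1)⁻¹ := by
        have := Real.rpow_le_rpow (by positivity) h2 (inv_nonneg.2 (sub_nonneg.2 hd.le))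
        rwa [Real.rpow_rpow_inv (by linarith) (by linarith)] at this
      rw [hts]
      exact mul_le_mul_of_nonneg_right (h5.trans (le_max_right _ _)) hεpos.le
    · calc _ ≤ 2 * s * ε := by nlinarith
        _ ≤ 2 * s * (A * _) := mul_le_mul_of_nonneg_left hhx (by positivity)
        _ = _ := by ring

/-- Space on the left of the images of the fundamental domain of a return map, based at a point
with comparable closest returns. -/
theorem IsReturnPair.iterate_ret_sub_le (hpair : IsReturnPair f q Q p P)
    (hf : IsControlledLift f Φ Λ) {x A B : ℝ} (hA : 1 ≤ A) (hB : 0 < B)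
    (hg : ∀ y, ret f q p y - y ≤ A * (ret f q p (ret f q p y) - ret f q p y))
    (hh : ∀ y, y - ret f Q P y ≤ A * (ret f Q P y - ret f Q P (ret f Q P y)))
    (hx : ret f q p x - x ≤ B * (x - ret f Q P x)) {j : ℕ} (hj : j ≤ Q) :
    f^[j] (ret f q p x) - f^[j] x ≤
      (1 + (1 + B) * A) * (1 + A) * Real.exp (3 * Λ) * (f^[j] x - f^[j] (ret f Q P x)) := by
  have hfj := hf.mono.iterate j
  have hQ : ∀ y, f^[Q - j] (f^[j] y) = ret f Q P y + P := fun y => by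
    rw [← Function.iterate_add_apply, Nat.sub_add_cancel hj, ret, sub_add_cancel]
  have h := (hpair.middle_le hf (N := 1) (k := 3) (m := Q - j) (M := (1 + B) * A) (M' := A)
    (hfj (hpair.ret_lt x)) (hfj (hpair.lt_ret x)) (hfj (hpair.lt_ret (ret f q p x)))
    (by
      have h := hfj.monotone (hpair.ret_ret_le hf.mono x)
      have comm : ∀ k y, f^[j] ((ret f q p)^[k] y) = (ret f q p)^[k] (f^[j] y) := fun k y =>
        (Function.Commute.iterate_right (fun y => iterate_ret hf.periodic j q p y) k) y
      rwa [comm] at h)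
    (by lia) (by positivity) (by linarith) ?_ ?_).1
  · convert h using 2
    push_cast
    rw [one_mul]
  all_goals
    simp only [hQ, add_sub_add_right_eq_sub, ret_comm hf.periodic q Q p P]
  · have := strictMono_ret hf.mono q p (hpair.ret_lt x)
    calc _ ≤ (1 + B) * (x - ret f Q P x) := by linarith
      _ ≤ (1 + B) * (A * _) := mul_le_mul_of_nonneg_left (hh x) (by positivity)
      _ = _ := by ring
  · exact hg _

theorem IsControlledLift.neg (hf : IsControlledLift f Φ Λ) :
    IsControlledLift (fun x => -f (-x)) (fun x => -Φ (-x)) Λ where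
  cont := (hf.cont.comp continuous_neg).neg
  mono := fun x y h => neg_lt_neg (hf.mono (neg_lt_neg h))
  periodic := fun x => by
    have := hf.periodic (-x - 1)
    rw [sub_add_cancel] at this
    rw [neg_add', this]
    ring
  pot_mono := fun x y h => neg_le_neg (hf.pot_mono (neg_le_neg h))
  pot_periodic := fun x => by
    have := hf.pot_periodic (-x - 1)
    rw [sub_add_cancel] at this
    rw [neg_add', this]
    ring
  crossRatio_le := fun a b c d hab hbc hcd => by
    have := hf.crossRatio_le _ _ _ _ (neg_lt_neg hcd) (neg_lt_neg hbc) (neg_lt_neg hab)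
    rw [crossRatio_neg] at this
    rw [crossRatio_neg]
    convert this using 3
    ring

theorem iterate_neg_neg (f : ℝ → ℝ) (n : ℕ) (x : ℝ) :
    (fun x => -f (-x))^[n] x = -f^[n] (-x) := by
  induction n generalizing x with
  | zero => simp
  | succ n ih => rw [Function.iterate_succ_apply, ih, neg_neg, Function.iterate_succ_apply]

theorem ret_neg_neg (f : ℝ → ℝ) (q : ℕ) (p : ℤ) (x : ℝ) :
    ret (fun x => -f (-x)) q (-p) x = -ret f q p (-x) := by
  rw [ret, ret, iterate_neg_neg]
  push_cast
  ring

end Space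

section RotationNumber

theorem HasRotNumber.neg {f : ℝ → ℝ} {ρ : ℝ} (h : HasRotNumber f ρ) :
    HasRotNumber (fun x => -f (-x)) (-ρ) := by
  unfold HasRotNumber
  simp only [iterate_neg_neg, neg_zero, neg_div]
  exact Tendsto.neg h

theorem HasRotNumber.exists_circleDeg1Lift {f : ℝ → ℝ} {ρ : ℝ} (h : HasRotNumber f ρ)
    (hf : Monotone f) (hper : ∀ x, f (x + 1) = f x + 1) :
    ∃ F : CircleDeg1Lift, (∀ n, ⇑(F ^ n) = f^[n]) ∧
      ∀ n : ℕ, (F ^ n).translationNumber = n * ρ := by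
  let F : CircleDeg1Lift := ⟨⟨f, hf⟩, hper⟩
  have hF : ∀ n, ⇑(F ^ n) = f^[n] := fun n => CircleDeg1Lift.coe_pow F n
  refine ⟨F, hF, fun n => ?_⟩
  have ht := F.tendsto_translation_number₀
  simp only [hF] at ht
  rw [CircleDeg1Lift.translationNumber_pow, tendsto_nhds_unique ht h]

theorem HasRotNumber.lt_ret {f : ℝ → ℝ} {ρ : ℝ} (h : HasRotNumber f ρ)
    (hf : Monotone f) (hper : ∀ x, f (x + 1) = f x + 1) {q : ℕ} {p : ℤ} (hp : p < q * ρ) (y : ℝ) :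
    y < ret f q p y := by
  obtain ⟨F, hF, hτ⟩ := h.exists_circleDeg1Lift hf hper
  have := (F ^ q).lt_map_of_int_lt_translationNumber (n := p) (by rwa [hτ]) y
  rw [hF] at this
  rw [ret]
  linarith

theorem HasRotNumber.ret_lt {f : ℝ → ℝ} {ρ : ℝ} (h : HasRotNumber f ρ)
    (hf : Monotone f) (hper : ∀ x, f (x + 1) = f x + 1) {q : ℕ} {p : ℤ} (hp : q * ρ < p) (y : ℝ) :
    ret f q p y < y := by
  obtain ⟨F, hF, hτ⟩ := h.exists_circleDeg1Lift hf hper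
  have := (F ^ q).map_lt_of_translationNumber_lt_int (n := p) (by rwa [hτ]) y
  rw [hF] at this
  rw [ret]
  linarith

theorem HasRotNumber.isReturnPair {f : ℝ → ℝ} {ρ : ℝ} (h : HasRotNumber f ρ)
    (hf : Monotone f) (hper : ∀ x, f (x + 1) = f x + 1) {q Q : ℕ} {p P : ℤ} (hq : q ≤ Q)
    (hdet : (q : ℤ) * P - Q * p = 1) (h1 : 0 < q * ρ - p) (h2 : q * ρ - p < 1)
    (h3 : Q * ρ - P < 0) (h4 : 0 < (q * ρ - p) + (Q * ρ - P)) : IsReturnPair f q Q p P where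
  le := hq
  det := hdet
  lt_ret := h.lt_ret hf hper (sub_pos.1 h1)
  ret_lt_add_one := fun y => by
    have := h.ret_lt hf hper (q := q) (p := p + 1) (by push_cast; linarith) y
    rw [ret] at this ⊢
    push_cast at this
    linarith
  ret_lt := h.ret_lt hf hper (by linarith)
  lt_ret_ret := fun y => by
    have := h.lt_ret hf hper (q := q + Q) (p := p + P) (by push_cast; linarith) y
    rw [ret, ret, iterate_sub_int hper, ← Function.iterate_add_apply]
    rw [ret] at this
    push_cast at this
    linarith

/-- The iterates of an irrational number under the Gauss map. -/
theorem gaussMap_iterate_mem {ρ : ℝ} (hρ : Irrational ρ) (n : ℕ) :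
    Irrational (gaussMap^[n] (Int.fract ρ)) ∧ gaussMap^[n] (Int.fract ρ) ∈ Ioo (0 : ℝ) 1 := by
  have key : ∀ x : ℝ, Irrational x → Irrational (Int.fract x) ∧ Int.fract x ∈ Ioo (0 : ℝ) 1 := by
    intro x hx
    have h : Irrational (Int.fract x) := hx.sub_intCast _
    exact ⟨h, (Int.fract_nonneg x).lt_of_ne h.ne_zero.symm, Int.fract_lt_one x⟩
  induction n with
  | zero => exact key ρ hρ
  | succ n ih =>
    rw [Function.iterate_succ_apply', gaussMap]
    exact key _ (irrational_inv_iff.2 ih.1)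

theorem inv_gaussMap_iterate {ρ : ℝ} (hρ : Irrational ρ) (n : ℕ) :
    (gaussMap^[n] (Int.fract ρ))⁻¹ = cfA ρ n + gaussMap^[n + 1] (Int.fract ρ) := by
  have h := (gaussMap_iterate_mem hρ n).2.1
  rw [Function.iterate_succ_apply', gaussMap, cfA, natCast_floor_eq_intCast_floor
    (inv_pos.2 h).le, Int.floor_add_fract]

theorem one_le_cfA {ρ : ℝ} (hρ : Irrational ρ) (n : ℕ) : 1 ≤ cfA ρ n := by
  have h := (gaussMap_iterate_mem hρ n).2
  rw [cfA, Nat.one_le_floor_iff]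
  exact (one_le_inv₀ h.1).2 h.2.le

theorem qden_le_succ {ρ : ℝ} (hρ : Irrational ρ) (n : ℕ) : qden ρ n ≤ qden ρ (n + 1) := by
  cases n with
  | zero => exact one_le_cfA hρ 0
  | succ n => exact le_add_right (Nat.le_mul_of_pos_left _ (one_le_cfA hρ _))

theorem qden_mul_pnum_sub (ρ : ℝ) (n : ℕ) :
    (qden ρ n : ℤ) * pnum ρ (n + 1) - qden ρ (n + 1) * pnum ρ n = (-1) ^ n := by
  induction n with
  | zero => simp [qden, pnum]
  | succ n ih =>
    rw [qden, pnum, pow_succ, ← ih]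
    push_cast
    ring

/-- The signed distance from `qₙ ρ` to the integer `pₙ`. -/
def convErr (ρ : ℝ) (n : ℕ) : ℝ := (-1) ^ n * (qden ρ n * ρ - pnum ρ n)

theorem convErr_succ {ρ : ℝ} (hρ : Irrational ρ) (h01 : ρ ∈ Ioo (0 : ℝ) 1) (n : ℕ) :
    convErr ρ (n + 1) = gaussMap^[n + 1] (Int.fract ρ) * convErr ρ n := by
  induction n with
  | zero =>
    have h := inv_gaussMap_iterate hρ 0
    rw [Function.iterate_zero, id, Int.fract_eq_self.2 ⟨h01.1.le, h01.2⟩] at h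
    have h0 := h01.1.ne'
    simp only [convErr, qden, pnum]
    rw [Int.fract_eq_self.2 ⟨h01.1.le, h01.2⟩, ← sub_eq_iff_eq_add'.2 h]
    field_simp
    push_cast
    ring
  | succ n ih =>
    have h := inv_gaussMap_iterate hρ (n + 1)
    have h0 := (gaussMap_iterate_mem hρ (n + 1)).2.1.ne'
    have hrec : convErr ρ (n + 2) = convErr ρ n - cfA ρ (n + 1) * convErr ρ (n + 1) := by
      simp only [convErr, qden, pnum]
      push_cast
      ring
    rw [hrec, ← sub_eq_iff_eq_add'.2 h, sub_mul, ih]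
    field_simp

theorem convErr_pos {ρ : ℝ} (hρ : Irrational ρ) (h01 : ρ ∈ Ioo (0 : ℝ) 1) (n : ℕ) :
    0 < convErr ρ n := by
  induction n with
  | zero => simpa [convErr, qden, pnum] using h01.1
  | succ n ih =>
    rw [convErr_succ hρ h01]
    exact mul_pos (gaussMap_iterate_mem hρ _).2.1 ih

theorem convErr_succ_lt {ρ : ℝ} (hρ : Irrational ρ) (h01 : ρ ∈ Ioo (0 : ℝ) 1) (n : ℕ) :
    convErr ρ (n + 1) < convErr ρ n := by
  rw [convErr_succ hρ h01]
  exact mul_lt_of_lt_one_left (convErr_pos hρ h01 n) (gaussMap_iterate_mem hρ _).2.2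

theorem convErr_lt_one {ρ : ℝ} (hρ : Irrational ρ) (h01 : ρ ∈ Ioo (0 : ℝ) 1) (n : ℕ) :
    convErr ρ n < 1 := by
  refine lt_of_le_of_lt (antitone_nat_of_succ_le (fun n => (convErr_succ_lt hρ h01 n).le)
    n.zero_le) ?_
  simpa [convErr, qden, pnum] using h01.2

/-- Up to a reflection, consecutive denominators of convergents are return pairs. -/
theorem HasRotNumber.isReturnPair_qden {f : ℝ → ℝ} {ρ : ℝ} (h : HasRotNumber f ρ)
    (hf : Monotone f) (hper : ∀ x, f (x + 1) = f x + 1) (hρ : Irrational ρ)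
    (h01 : ρ ∈ Ioo (0 : ℝ) 1) (n : ℕ) :
    IsReturnPair f (qden ρ n) (qden ρ (n + 1)) (pnum ρ n) (pnum ρ (n + 1)) ∨
      IsReturnPair (fun x => -f (-x)) (qden ρ n) (qden ρ (n + 1))
        (-(pnum ρ n : ℤ)) (-(pnum ρ (n + 1) : ℤ)) := by
  have hdet := qden_mul_pnum_sub ρ n
  have e1 := convErr_pos hρ h01 n
  have e2 := convErr_lt_one hρ h01 n
  have e3 := convErr_pos hρ h01 (n + 1)
  have e4 := convErr_succ_lt hρ h01 n
  simp only [convErr, pow_succ] at e1 e2 e3 e4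
  rcases neg_one_pow_eq_or ℤ n with hs | hs
  · left
    have hs' : (-1 : ℝ) ^ n = 1 := by exact_mod_cast congrArg (Int.cast : ℤ → ℝ) hs
    rw [hs'] at e1 e2 e3 e4
    rw [hs] at hdet
    refine h.isReturnPair hf hper (qden_le_succ hρ n) hdet ?_ ?_ ?_ ?_ <;> push_cast <;> linarith
  · right
    have hs' : (-1 : ℝ) ^ n = -1 := by exact_mod_cast congrArg (Int.cast : ℤ → ℝ) hs
    rw [hs'] at e1 e2 e3 e4
    rw [hs] at hdet
    refine h.neg.isReturnPair (fun x y hxy => neg_le_neg (hf (neg_le_neg hxy))) (fun x => ?_)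
      (qden_le_succ hρ n) (by linarith) ?_ ?_ ?_ ?_
    · have := hper (-x - 1)
      rw [sub_add_cancel] at this
      rw [neg_add', this]
      ring
    all_goals push_cast; linarith

end RotationNumber

section Assembly

variable {f : ℝ → ℝ} {Φ : ℝ → ℝ} {Λ : ℝ} {q Q : ℕ} {p P : ℤ}

/-- Two-sided form of the comparability of consecutive displacements of a return map. -/
def HasRetGapLE (A : ℝ) (f : ℝ → ℝ) (q : ℕ) (p : ℤ) : Prop :=
  ∀ y, |ret f q p y - y| ≤ A * |ret f q p (ret f q p y) - ret f q p y|

theorem hasRetGapLE_neg_iff {A : ℝ} :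
    HasRetGapLE A (fun x => -f (-x)) q (-p) ↔ HasRetGapLE A f q p := by
  have e : ∀ a b : ℝ, |-a - -b| = |a - b| := fun a b => by
    rw [neg_sub_neg, abs_sub_comm]
  simp only [HasRetGapLE, ret_neg_neg, neg_neg]
  refine ⟨fun h y => ?_, fun h y => ?_⟩
  · have := h (-y)
    simpa only [neg_neg, e] using this
  · have := h (-y)
    rwa [← e, ← e (ret f q p (ret f q p (-y))), neg_neg] at this

theorem IsReturnPair.hasRetGapLE (hpair : IsReturnPair f q Q p P) {A : ℝ}
    (h : ∀ x, ret f q p x - x ≤ A * (ret f q p (ret f q p x) - ret f q p x)) :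
    HasRetGapLE A f q p := fun y => by
  rw [abs_of_pos (sub_pos.2 (hpair.lt_ret _)), abs_of_pos (sub_pos.2 (hpair.lt_ret _))]
  exact h y

/-- The multiplicative constant by which `|f^j(Iₙ)|` is controlled by `|f^j(I_{n+1})|`. -/
def spaceConst (Λ d κ K A : ℝ) : ℝ :=
  (1 + (1 + max 1 ((3 * A * (1 + A) * Real.exp (3 * Λ) * K / κ) ^ (d - 1)⁻¹)) * A) * (1 + A) *
    Real.exp (3 * Λ)

theorem IsReturnPair.abs_iterate_ret_sub_le (hpair : IsReturnPair f q Q p P)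
    (hf : IsControlledLift f Φ Λ) {x d κ K A : ℝ} (hd : 1 < d) (hκ : 0 < κ) (hK : 0 < K)
    (hA : 1 ≤ A)
    (hgrow : ∀ y, |y - x| ≤ 1 →
      κ * |y - x| ^ d ≤ |f y - f x| ∧ |f y - f x| ≤ K * |y - x| ^ d)
    (hg : HasRetGapLE A f q p) (hh : HasRetGapLE A f Q P) {j : ℕ} (hj : j ≤ Q) :
    |f^[j] (ret f q p x) - f^[j] x| ≤
      spaceConst Λ d κ K A * |f^[j] (ret f Q P x) - f^[j] x| := by
  have hg' : ∀ y, ret f q p y - y ≤ A * (ret f q p (ret f q p y) - ret f q p y) := fun y => by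
    have := hg y
    rwa [abs_of_pos (sub_pos.2 (hpair.lt_ret _)), abs_of_pos (sub_pos.2 (hpair.lt_ret _))] at this
  have hh' : ∀ y, y - ret f Q P y ≤ A * (ret f Q P y - ret f Q P (ret f Q P y)) := fun y => by
    have := hh y
    rwa [abs_of_neg (sub_neg.2 (hpair.ret_lt _)), abs_of_neg (sub_neg.2 (hpair.ret_lt _)),
      neg_sub, neg_sub] at this
  have hB := hpair.ret_sub_le_of_growth hf hd hκ hK hA hgrow hg' hh'
  have h := hpair.iterate_ret_sub_le hf hA (lt_max_of_lt_left one_pos) hg' hh' hB hj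
  rwa [abs_of_pos (sub_pos.2 (hf.mono.iterate j (hpair.lt_ret x))),
    abs_of_neg (sub_neg.2 (hf.mono.iterate j (hpair.ret_lt x))), neg_sub]

end Assembly

end MCircle

/-- **Uniform space around `f^j(Iₙ)`** (Fact 3.4). For a multicritical circle map `f`
with irrational rotation number and fixed critical point `c₀`, setting `Lₙ = I_{n+1}`
and `Rₙ = f^{qₙ}(Iₙ)`, there is `τ = τ(f) > 0` such that for all `n` and all
`0 ≤ j ≤ q_{n+1}` one has `|f^j(Lₙ)| > τ|f^j(Iₙ)|` and `|f^j(Rₙ)| > τ|f^j(Iₙ)|`.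
(Note `|f^j(Lₙ)| = |f^j(I_{n+1})|` and `|f^j(Rₙ)| = |f^{j+qₙ}(Iₙ)|`.) -/
theorem space_around_images (f : ℝ → ℝ) (C : Finset ℝ) (dc : ℝ → ℝ) (ρ c₀ : ℝ)
    (hf : GoodMap f C dc ρ) (hc₀ : c₀ ∈ C) :
    ∃ τ : ℝ, 0 < τ ∧ ∀ n : ℕ, ∀ j ≤ qden ρ (n + 1),
      τ * arcImgLen f ρ c₀ n j < arcImgLen f ρ c₀ (n + 1) j ∧
      τ * arcImgLen f ρ c₀ n j < arcImgLen f ρ c₀ n (j + qden ρ n) := by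
  obtain ⟨hmc, hrot, hρ, h01⟩ := hf
  obtain ⟨Φ, Λ, hctrl⟩ := hmc.exists_isControlledLift
  obtain ⟨d, hd, κ, hκ, K, hK, hgrow⟩ :=
    hmc.exists_growth ((hmc.2.2.2.1 c₀).2 ⟨c₀, hc₀, 0, by simp⟩)
  obtain ⟨A, hA, hgap⟩ := exists_ret_gap_le Λ
  have hper := hctrl.periodic
  have pair := hrot.isReturnPair_qden hctrl.mono.monotone hper hρ h01
  have gap : ∀ n, HasRetGapLE A f (qden ρ n) (pnum ρ n) := fun n => by
    rcases pair n with h | h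
    · exact h.hasRetGapLE (hgap _ _ _ _ _ _ hctrl h)
    · exact hasRetGapLE_neg_iff.1 (h.hasRetGapLE (hgap _ _ _ _ _ _ hctrl.neg h))
  have ret_ne : ∀ n y, ret f (qden ρ n) (pnum ρ n) y ≠ y := fun n y => by
    rcases pair n with h | h
    · exact (h.lt_ret y).ne'
    · have := (h.lt_ret (-y)).ne'
      rw [ret_neg_neg, neg_neg] at this
      exact fun h' => this (congrArg _ h')
  have retPt_eq : ∀ n, retPt f ρ c₀ n = ret f (qden ρ n) (pnum ρ n) c₀ := fun n => by
    rw [retPt, ret, Int.cast_natCast]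
  have len_eq : ∀ n j, arcImgLen f ρ c₀ n j =
      |ret f (qden ρ n) (pnum ρ n) (f^[j] c₀) - f^[j] c₀| := fun n j => by
    rw [arcImgLen, retPt_eq, iterate_ret hper]
  have len_pos : ∀ n j, 0 < arcImgLen f ρ c₀ n j := fun n j => by
    rw [len_eq]
    exact abs_pos.2 (sub_ne_zero.2 (ret_ne _ _))
  have next : ∀ n j, j ≤ qden ρ (n + 1) →
      arcImgLen f ρ c₀ n j ≤ spaceConst Λ d κ K A * arcImgLen f ρ c₀ (n + 1) j := by
    intro n j hj
    rw [arcImgLen, arcImgLen, retPt_eq, retPt_eq]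
    rcases pair n with h | h
    · exact h.abs_iterate_ret_sub_le hctrl hd hκ hK hA hgrow (gap n) (gap (n + 1)) hj
    · have e : ∀ a b : ℝ, |-a - -b| = |a - b| := fun a b => by
        rw [neg_sub_neg, abs_sub_comm]
      have := h.abs_iterate_ret_sub_le (x := -c₀) hctrl.neg hd hκ hK hA (fun y hy => by
          have e' : y - -c₀ = -(-y - c₀) := by ring
          rw [e', abs_neg] at hy ⊢
          rw [e, neg_neg]
          exact hgrow (-y) hy)
        (hasRetGapLE_neg_iff.2 (gap n)) (hasRetGapLE_neg_iff.2 (gap (n + 1))) hj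
      simpa only [ret_neg_neg, iterate_neg_neg, neg_neg, e] using this
  have same : ∀ n j, arcImgLen f ρ c₀ n j ≤ A * arcImgLen f ρ c₀ n (j + qden ρ n) := by
    intro n j
    have hshift : f^[j + qden ρ n] c₀ =
        ret f (qden ρ n) (pnum ρ n) (f^[j] c₀) + (pnum ρ n : ℤ) := by
      rw [ret, sub_add_cancel, add_comm, Function.iterate_add_apply]
    rw [len_eq, len_eq, hshift, ret_add_int hper, add_sub_add_right_eq_sub]
    exact gap n _
  have hS : 0 < spaceConst Λ d κ K A := by
    unfold spaceConst
    positivity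
  refine ⟨(spaceConst Λ d κ K A + A)⁻¹, by positivity, fun n j hj => ?_⟩
  rw [inv_mul_lt_iff₀ (by positivity), inv_mul_lt_iff₀ (by positivity)]
  constructor
  · nlinarith [next n j hj, len_pos (n + 1) j]
  · nlinarith [same n j, len_pos n (j + qden ρ n)]
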